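/- (Monneau monotonicity formula.) Let u be a solution of the normalized obstacle problem on Ω with 0 ∈ Σ a singular point, B_ρ(0) ⊆ Ω, and let p ∈ 𝒫. Then the function r ↦ M(r,u,p) := r^{−(n+3)} ∫_{∂B_r(0)} (u − p)² dσ is nondecreasing on (0, ρ). -/

import Mathlib

open MeasureTheory Filter Metric Set
open scoped NNReal ENNReal Topology

noncomputable section

/-- The (pointwise a.e. defined) Laplacian of a `C^{1,1}_loc` function, as the
trace of the derivative of the gradient. -/
def lapGrad {n : ℕ} (w : EuclideanSpace ℝ (Fin n) → ℝ)
    (x : EuclideanSpace ℝ (Fin n)) : ℝ :=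
  ∑ i : Fin n, fderiv ℝ (gradient w) x (EuclideanSpace.single i 1) i

/-- `u` is a solution of the normalized obstacle problem on `Ω`:
`u ∈ C^{1,1}_loc(Ω)`, `u ≥ 0`, and `Δu = χ_{{u>0}}` a.e. on `Ω`. -/
def IsObstacleSol {n : ℕ} (Ω : Set (EuclideanSpace ℝ (Fin n)))
    (u : EuclideanSpace ℝ (Fin n) → ℝ) : Prop :=
  (∀ x ∈ Ω, DifferentiableAt ℝ u x) ∧
  (∀ K : Set (EuclideanSpace ℝ (Fin n)), K ⊆ Ω → IsCompact K →
    ∃ L : ℝ≥0, LipschitzOnWith L (gradient u) K) ∧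
  (∀ x ∈ Ω, 0 ≤ u x) ∧
  (∀ᵐ x ∂(volume.restrict Ω), lapGrad u x = if 0 < u x then 1 else 0)

/-- The free boundary `∂{u > 0} ∩ Ω`. -/
def freeBoundary {n : ℕ} (Ω : Set (EuclideanSpace ℝ (Fin n)))
    (u : EuclideanSpace ℝ (Fin n) → ℝ) : Set (EuclideanSpace ℝ (Fin n)) :=
  frontier {x | x ∈ Ω ∧ 0 < u x} ∩ Ω

/-- The quadratic polynomial `p(x) = (1/2)⟨Ax, x⟩` associated with a matrix `A`. -/
def quadForm {n : ℕ} (A : Matrix (Fin n) (Fin n) ℝ)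
    (x : EuclideanSpace ℝ (Fin n)) : ℝ :=
  (1 / 2) * ∑ i, ∑ j, A i j * x i * x j

/-- `A` encodes an element of `𝒫`: a symmetric nonnegative-definite matrix of
trace `1`. -/
def MemP {n : ℕ} (A : Matrix (Fin n) (Fin n) ℝ) : Prop :=
  A.PosSemidef ∧ A.trace = 1

/-- `x0` is a singular free boundary point: along some sequence `r_k → 0⁺` the
rescalings `u(x0 + r_k x)/r_k²` converge locally uniformly to some `p ∈ 𝒫`. -/
def IsSingularPt {n : ℕ} (Ω : Set (EuclideanSpace ℝ (Fin n)))
    (u : EuclideanSpace ℝ (Fin n) → ℝ) (x0 : EuclideanSpace ℝ (Fin n)) : Prop :=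
  x0 ∈ freeBoundary Ω u ∧
  ∃ (r : ℕ → ℝ) (A : Matrix (Fin n) (Fin n) ℝ),
    (∀ k, 0 < r k) ∧ Tendsto r atTop (𝓝 0) ∧ MemP A ∧
    TendstoLocallyUniformly (fun k x => u (x0 + r k • x) / r k ^ 2)
      (quadForm A) atTop

/-- `p(x) = (1/2)⟨Ax, x⟩ ∈ 𝒫` is the (full) blow-up of `u` at `x0`:
`u(x0 + r x)/r² → p(x)` locally uniformly as `r → 0⁺`. -/
def IsBlowup {n : ℕ} (u : EuclideanSpace ℝ (Fin n) → ℝ)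
    (x0 : EuclideanSpace ℝ (Fin n)) (A : Matrix (Fin n) (Fin n) ℝ) : Prop :=
  MemP A ∧
  TendstoLocallyUniformly (fun (r : ℝ) x => u (x0 + r • x) / r ^ 2)
    (quadForm A) (𝓝[>] 0)

/-- The Monneau quantity `M(r,u,p) = r^{-(n+3)} ∫_{∂B_r} (u-p)² dσ`, where the
boundary integral is taken with respect to the `(n-1)`-dimensional surface
(Hausdorff) measure on the sphere. -/
def monneauM (n : ℕ) (u : EuclideanSpace ℝ (Fin n) → ℝ)
    (A : Matrix (Fin n) (Fin n) ℝ) (r : ℝ) : ℝ :=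
  (∫ x in sphere (0 : EuclideanSpace ℝ (Fin n)) r,
      (u x - quadForm A x) ^ 2 ∂(μH[(n : ℝ) - 1])) / r ^ (n + 3)


set_option linter.unusedSectionVars false

lemma polar_integral {E : Type*} [NormedAddCommGroup E] [NormedSpace ℝ E] [FiniteDimensional ℝ E]
    [MeasurableSpace E] [BorelSpace E] [Nontrivial E] (μ : Measure E) [μ.IsAddHaarMeasure]
    (F : E → ℝ) (hF : Integrable F μ) :
    ∫ x, F x ∂μ = ∫ t in Ioi (0 : ℝ), t ^ (Module.finrank ℝ E - 1) *
      ∫ θ : sphere (0 : E) 1, F (t • (θ : E)) ∂μ.toSphere := by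
  have hmp := μ.measurePreserving_homeomorphUnitSphereProd
  have hemb := (homeomorphUnitSphereProd E).measurableEmbedding
  have hmeas : MeasurableSet ({(0 : E)}ᶜ) := (measurableSet_singleton _).compl
  let G : sphere (0 : E) 1 × Ioi (0 : ℝ) → ℝ := fun p => F (p.2.1 • p.1.1)
  have hG : ∀ x : ({(0 : E)}ᶜ : Set E), G (homeomorphUnitSphereProd E x) = F x := by
    intro x
    simp only [G]
    congr 1
    have := congrArg Subtype.val ((homeomorphUnitSphereProd E).symm_apply_apply x)
    rw [← this]; simp
    rw [smul_smul, mul_inv_cancel₀ (norm_ne_zero_iff.2 x.2), one_smul]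
  have hint : Integrable G (μ.toSphere.prod (.volumeIoiPow (Module.finrank ℝ E - 1))) := by
    rw [← hmp.integrable_comp_emb hemb]
    have : (G ∘ homeomorphUnitSphereProd E) = F ∘ Subtype.val := funext hG
    rw [this, ← integrableOn_iff_comap_subtypeVal hmeas]
    exact hF.integrableOn
  calc
    ∫ x, F x ∂μ = ∫ x : ({(0)}ᶜ : Set E), F x.1 ∂(μ.comap (↑)) := by
      rw [integral_subtype_comap hmeas F, restrict_compl_singleton]
    _ = ∫ p, G p ∂μ.toSphere.prod (.volumeIoiPow (Module.finrank ℝ E - 1)) := by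
      rw [← hmp.integral_comp hemb]
      exact integral_congr_ae (.of_forall fun x => (hG x).symm)
    _ = ∫ t : Ioi (0 : ℝ), (∫ θ : sphere (0 : E) 1, F (t.1 • (θ : E)) ∂μ.toSphere)
          ∂.volumeIoiPow (Module.finrank ℝ E - 1) := by
      rw [integral_prod_symm _ hint]
    _ = _ := by
      simp only [Measure.volumeIoiPow, ENNReal.ofReal]
      rw [integral_withDensity_eq_integral_smul,
        integral_subtype_comap measurableSet_Ioi fun a ↦
          Real.toNNReal (a ^ (Module.finrank ℝ E - 1)) •
            ∫ θ : sphere (0 : E) 1, F (a • (θ : E)) ∂μ.toSphere,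
        setIntegral_congr_fun measurableSet_Ioi fun x hx ↦ ?_]
      · rw [NNReal.smul_def, Real.coe_toNNReal _ (pow_nonneg hx.out.le _)]; rfl
      · exact (measurable_subtype_coe.pow_const _).real_toNNReal

section
variable {E : Type*} [NormedAddCommGroup E] [InnerProductSpace ℝ E] [FiniteDimensional ℝ E]
    [MeasurableSpace E] [BorelSpace E] [Nontrivial E] (μ : Measure E) [μ.IsAddHaarMeasure]

lemma annulus_limit (f : E → ℝ) (hf : Continuous f) (v : E) :
    Tendsto (fun δ : ℝ => δ⁻¹ * ∫ x in ball (0 : E) 1 \ closedBall 0 (1 - δ),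
        inner ℝ x v / ‖x‖ * f x ∂μ) (𝓝[>] 0)
      (𝓝 (∫ θ : sphere (0 : E) 1, inner ℝ (θ : E) v * f θ ∂μ.toSphere)) := by
  set ψ : ℝ → ℝ := fun t => t ^ (Module.finrank ℝ E - 1) *
      ∫ θ : sphere (0 : E) 1, inner ℝ (θ : E) v * f (t • (θ : E)) ∂μ.toSphere with hψ
  have hψc : Continuous ψ := by
    refine (continuous_pow _).mul ?_
    have := continuous_parametric_integral_of_continuous (X := ℝ) (Y := sphere (0 : E) 1)
      (μ := μ.toSphere) (f := fun t θ => inner ℝ (θ : E) v * f (t • (θ : E))) (by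
        simp only [Function.uncurry_def]; fun_prop) (s := univ) isCompact_univ
    simpa using this
  have hψ1 : ψ 1 = ∫ θ : sphere (0 : E) 1, inner ℝ (θ : E) v * f θ ∂μ.toSphere := by
    simp [hψ]
  rw [← hψ1]
  have key : ∀ δ ∈ Ioo (0 : ℝ) 1, ∫ x in ball (0 : E) 1 \ closedBall 0 (1 - δ),
        inner ℝ x v / ‖x‖ * f x ∂μ = ∫ t in (1 - δ)..1, ψ t := by
    intro δ hδ
    have hms : MeasurableSet (ball (0 : E) 1 \ closedBall 0 (1 - δ)) :=
      measurableSet_ball.diff measurableSet_closedBall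
    have hsub : ball (0 : E) 1 \ closedBall 0 (1 - δ) ⊆ closedBall 0 1 \ ball 0 (1 - δ) :=
      fun x hx => ⟨ball_subset_closedBall hx.1, fun h => hx.2 (ball_subset_closedBall h)⟩
    have hcomp : IsCompact (closedBall (0 : E) 1 \ ball 0 (1 - δ)) :=
      (isCompact_closedBall 0 1).diff isOpen_ball
    have hint : IntegrableOn (fun x => inner ℝ x v / ‖x‖ * f x)
        (ball (0 : E) 1 \ closedBall 0 (1 - δ)) μ := by
      refine IntegrableOn.mono_set (ContinuousOn.integrableOn_compact hcomp ?_) hsub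
      refine ContinuousOn.mul (ContinuousOn.div (by fun_prop) (by fun_prop) ?_) hf.continuousOn
      intro x hx h0
      apply hx.2
      rw [mem_ball_zero_iff, h0]; linarith [hδ.2]
    rw [← integral_indicator hms, polar_integral μ _ ((integrable_indicator_iff hms).2 hint),
      intervalIntegral.integral_of_le (by linarith [hδ.1]), integral_Ioc_eq_integral_Ioo]
    rw [← integral_indicator measurableSet_Ioi, ← integral_indicator measurableSet_Ioo]
    congr 1
    ext t
    by_cases ht0 : 0 < t
    · rw [indicator_of_mem (by exact ht0)]
      by_cases ht : t ∈ Ioo (1 - δ) 1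
      · rw [indicator_of_mem ht, hψ]
        congr 1
        refine integral_congr_ae (.of_forall fun θ => ?_)
        have hθ : ‖(θ : E)‖ = 1 := norm_eq_of_mem_sphere θ
        have hn : ‖t • (θ : E)‖ = t := by rw [norm_smul, hθ, mul_one, Real.norm_of_nonneg ht0.le]
        have hmem : t • (θ : E) ∈ ball (0 : E) 1 \ closedBall 0 (1 - δ) := by
          simp only [Set.mem_sdiff, mem_ball_zero_iff, mem_closedBall_zero_iff, hn]
          exact ⟨ht.2, not_le.2 ht.1⟩
        simp only [indicator_of_mem hmem]
        rw [hn, inner_smul_left]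
        simp only [conj_trivial]
        field_simp
      · rw [indicator_of_notMem ht]
        have : ∀ θ : sphere (0 : E) 1, (ball (0 : E) 1 \ closedBall 0 (1 - δ)).indicator
            (fun x => inner ℝ x v / ‖x‖ * f x) (t • (θ : E)) = 0 := by
          intro θ
          have hθ : ‖(θ : E)‖ = 1 := norm_eq_of_mem_sphere θ
          have hn : ‖t • (θ : E)‖ = t := by rw [norm_smul, hθ, mul_one, Real.norm_of_nonneg ht0.le]
          apply indicator_of_notMem
          simp only [Set.mem_sdiff, mem_ball_zero_iff, mem_closedBall_zero_iff, hn]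
          intro h; exact ht ⟨not_le.1 h.2, h.1⟩
        simp [this]
    · rw [indicator_of_notMem (by exact ht0), indicator_of_notMem]
      intro h; exact ht0 (by linarith [h.1, hδ.2])
  have hder : HasDerivAt (fun u => ∫ x in u..1, ψ x) (-ψ 1) 1 :=
    intervalIntegral.integral_hasDerivAt_left (by simp)
      (hψc.stronglyMeasurableAtFilter _ _) hψc.continuousAt
  have hder2 : HasDerivAt (fun δ : ℝ => ∫ x in (1 - δ)..1, ψ x) (ψ 1) 0 := by
    have h1 : HasDerivAt (fun δ : ℝ => 1 - δ) (-1) 0 := by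
      simpa using (hasDerivAt_id (0:ℝ)).const_sub 1
    have := HasDerivAt.comp (0:ℝ) (h₂ := fun u => ∫ x in u..1, ψ x) (h := fun δ : ℝ => 1 - δ) (h₂' := -ψ 1) (by simpa using hder) h1
    simpa [Function.comp_def] using this
  have := hder2.tendsto_slope_zero_right
  refine this.congr' ?_
  filter_upwards [Ioo_mem_nhdsGT (zero_lt_one' ℝ)] with δ hδ
  rw [key δ hδ]; simp

/-- cutoff -/
def cutoff (δ : ℝ) (x : E) : ℝ := max 0 (min 1 (δ⁻¹ * (1 - ‖x‖)))

lemma cutoff_lip {δ : ℝ} (hδ : 0 < δ) : ∃ C : ℝ≥0, LipschitzWith C (cutoff δ : E → ℝ) := by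
  refine ⟨⟨δ⁻¹, by positivity⟩, ?_⟩
  refine LipschitzWith.const_max (LipschitzWith.const_min ?_ 1) 0
  refine LipschitzWith.of_dist_le_mul fun x y => ?_
  rw [Real.dist_eq, ← mul_sub, abs_mul, abs_of_pos (by positivity : 0 < δ⁻¹), dist_eq_norm]
  change _ ≤ δ⁻¹ * _
  gcongr
  have := abs_norm_sub_norm_le y x
  rw [norm_sub_rev y x] at this
  rwa [show 1 - ‖x‖ - (1 - ‖y‖) = ‖y‖ - ‖x‖ by ring]

lemma cutoff_compact {δ : ℝ} (hδ : 0 < δ) : HasCompactSupport (cutoff δ : E → ℝ) := by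
  refine HasCompactSupport.intro (isCompact_closedBall (0:E) 1) fun x hx => ?_
  rw [mem_closedBall_zero_iff, not_le] at hx
  have : δ⁻¹ * (1 - ‖x‖) ≤ 0 := mul_nonpos_of_nonneg_of_nonpos (by positivity) (by linarith)
  simp [cutoff, this]

lemma cutoff_lineDeriv_ann {δ : ℝ} (hδ : 0 < δ) (hδ1 : δ < 1) (v x : E)
    (hx : x ∈ ball (0 : E) 1 \ closedBall 0 (1 - δ)) :
    lineDeriv ℝ (cutoff δ) x (-v) = δ⁻¹ * (inner ℝ x v / ‖x‖) := by
  have hopen : IsOpen (ball (0 : E) 1 \ closedBall 0 (1 - δ)) := isOpen_ball.sdiff isClosed_closedBall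
  have hx0 : ‖x‖ ≠ 0 := by
    intro h
    apply hx.2
    rw [mem_closedBall_zero_iff, h]; linarith
  have heq : (cutoff δ : E → ℝ) =ᶠ[𝓝 x] fun y => δ⁻¹ * (1 - ‖y‖) := by
    filter_upwards [hopen.mem_nhds hx] with y hy
    have h1 : ‖y‖ < 1 := by simpa using hy.1
    have h2 : 1 - δ < ‖y‖ := by simpa using hy.2
    have h3 : 0 ≤ δ⁻¹ * (1 - ‖y‖) := mul_nonneg (by positivity) (by linarith)
    have h4 : δ⁻¹ * (1 - ‖y‖) ≤ 1 := by
      rw [inv_mul_le_iff₀ hδ]; linarith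
    simp [cutoff, h3, h4]
  rw [heq.lineDeriv_eq]
  apply HasLineDerivAt.lineDeriv
  have h1 : HasDerivAt (fun t : ℝ => x + t • (-v)) (-v) 0 := by
    simpa using ((hasDerivAt_id (0:ℝ)).smul_const (-v)).const_add x
  have h2 := h1.norm_sq
  have h3 := (h2.sqrt (by simpa using hx0)).const_sub 1 |>.const_mul δ⁻¹
  unfold HasLineDerivAt
  refine (h3.congr_deriv ?_).congr_of_eventuallyEq (.of_forall fun t => ?_)
  · simp [inner_neg_right]
    field_simp
  · simp

lemma cutoff_lineDeriv_in {δ : ℝ} (hδ : 0 < δ) (v x : E)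
    (hx : x ∈ ball (0 : E) (1 - δ)) :
    lineDeriv ℝ (cutoff δ) x v = 0 := by
  have heq : (cutoff δ : E → ℝ) =ᶠ[𝓝 x] fun y => 1 := by
    filter_upwards [isOpen_ball.mem_nhds hx] with y hy
    have h1 : ‖y‖ < 1 - δ := by simpa using hy
    have h4 : 1 ≤ δ⁻¹ * (1 - ‖y‖) := by
      rw [le_inv_mul_iff₀ hδ]; linarith
    simp [cutoff, h4]
  rw [heq.lineDeriv_eq]
  simp [lineDeriv]

lemma cutoff_lineDeriv_out {δ : ℝ} (hδ : 0 < δ) (v x : E)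
    (hx : x ∉ closedBall (0 : E) 1) :
    lineDeriv ℝ (cutoff δ) x v = 0 := by
  have heq : (cutoff δ : E → ℝ) =ᶠ[𝓝 x] fun y => 0 := by
    filter_upwards [isClosed_closedBall.isOpen_compl.mem_nhds hx] with y hy
    have h1 : 1 < ‖y‖ := by simpa using hy
    have h4 : δ⁻¹ * (1 - ‖y‖) ≤ 0 :=  mul_nonpos_of_nonneg_of_nonpos (by positivity) (by linarith)
    simp [cutoff, h4]
  rw [heq.lineDeriv_eq]
  simp [lineDeriv]

/-- Divergence theorem on the unit ball for a Lipschitz function. -/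
lemma lip_div_ball {C : ℝ≥0} (f : E → ℝ) (hf : LipschitzWith C f) (v : E) :
    ∫ x in ball (0 : E) 1, lineDeriv ℝ f x v ∂μ =
      ∫ θ : sphere (0 : E) 1, inner ℝ (θ : E) v * f θ ∂μ.toSphere := by
  have hlim1 := annulus_limit μ f hf.continuous v
  have hlim2 : Tendsto (fun δ : ℝ => ∫ x, lineDeriv ℝ f x v * cutoff δ x ∂μ) (𝓝[>] 0)
      (𝓝 (∫ x in ball (0 : E) 1, lineDeriv ℝ f x v ∂μ)) := by
    rw [← integral_indicator measurableSet_ball]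
    refine tendsto_integral_filter_of_dominated_convergence
      ((closedBall (0:E) 1).indicator fun _ => C * ‖v‖) ?_ ?_ ?_ ?_
    · filter_upwards [self_mem_nhdsWithin] with δ hδ
      obtain ⟨D, hD⟩ := cutoff_lip (E := E) hδ
      exact ((measurable_lineDeriv hf.continuous).mul hD.continuous.measurable).aestronglyMeasurable
    · filter_upwards [self_mem_nhdsWithin] with δ hδ
      refine .of_forall fun x => ?_
      by_cases hx : x ∈ closedBall (0:E) 1
      · rw [indicator_of_mem hx, norm_mul]
        have h1 : ‖lineDeriv ℝ f x v‖ ≤ C * ‖v‖ := norm_lineDeriv_le_of_lipschitz ℝ hf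
        have h2 : ‖cutoff δ x‖ ≤ 1 := by
          rw [cutoff, Real.norm_of_nonneg (le_max_left _ _)]
          exact max_le zero_le_one (min_le_left _ _)
        calc _ ≤ (C * ‖v‖) * 1 := by gcongr
          _ = _ := mul_one _
      · rw [indicator_of_notMem hx]
        rw [mem_closedBall_zero_iff, not_le] at hx
        have : δ⁻¹ * (1 - ‖x‖) ≤ 0 :=
          mul_nonpos_of_nonneg_of_nonpos (by have : 0 < δ := hδ; positivity) (by linarith)
        simp [cutoff, this]
    · rw [integrable_indicator_iff measurableSet_closedBall]
      exact integrableOn_const (measure_closedBall_lt_top.ne)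
    · refine .of_forall fun x => ?_
      by_cases hx : x ∈ ball (0:E) 1
      · rw [indicator_of_mem hx]
        rw [mem_ball_zero_iff] at hx
        refine tendsto_const_nhds.congr' ?_
        filter_upwards [Ioo_mem_nhdsGT (sub_pos.2 hx)] with δ hδ
        have h4 : 1 ≤ δ⁻¹ * (1 - ‖x‖) := by
          rw [le_inv_mul_iff₀ hδ.1]; linarith [hδ.2]
        simp [cutoff, h4]
      · rw [indicator_of_notMem hx]
        refine tendsto_const_nhds.congr' ?_
        rw [mem_ball_zero_iff, not_lt] at hx
        filter_upwards [self_mem_nhdsWithin] with δ hδ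
        have : δ⁻¹ * (1 - ‖x‖) ≤ 0 :=
          mul_nonpos_of_nonneg_of_nonpos (by have : 0 < δ := hδ; positivity) (by linarith)
        simp [cutoff, this]
  refine tendsto_nhds_unique hlim2 (hlim1.congr' ?_)
  filter_upwards [Ioo_mem_nhdsGT (zero_lt_one' ℝ)] with δ hδ
  obtain ⟨D, hD⟩ := cutoff_lip (E := E) hδ.1
  rw [hf.integral_lineDeriv_mul_eq hD (cutoff_compact hδ.1)]
  have hms : MeasurableSet (ball (0 : E) 1 \ closedBall 0 (1 - δ)) :=
    measurableSet_ball.diff measurableSet_closedBall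
  rw [← integral_const_mul, ← integral_indicator hms]
  refine integral_congr_ae ?_
  have hs1 : ∀ᵐ x ∂μ, x ∉ sphere (0:E) 1 := measure_eq_zero_iff_ae_notMem.1 (Measure.addHaar_sphere μ 0 1)
  have hs2 : ∀ᵐ x ∂μ, x ∉ sphere (0:E) (1 - δ) := measure_eq_zero_iff_ae_notMem.1 (Measure.addHaar_sphere μ 0 _)
  filter_upwards [hs1, hs2] with x h1 h2
  by_cases hx : x ∈ ball (0 : E) 1 \ closedBall 0 (1 - δ)
  · rw [indicator_of_mem hx, cutoff_lineDeriv_ann hδ.1 hδ.2 v x hx]; ring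
  · rw [indicator_of_notMem hx]
    rw [mem_sphere_zero_iff_norm] at h1 h2
    simp only [Set.mem_sdiff, mem_ball_zero_iff, mem_closedBall_zero_iff, not_and, not_not] at hx
    rcases lt_or_gt_of_ne h1 with h | h
    · rw [cutoff_lineDeriv_in hδ.1, zero_mul]
      rw [mem_ball_zero_iff]
      exact lt_of_le_of_ne (hx h) h2
    · rw [cutoff_lineDeriv_out hδ.1, zero_mul]
      simpa using h
end



/-- pointwise divergence -/
def dvg {n : ℕ} (V : EuclideanSpace ℝ (Fin n) → EuclideanSpace ℝ (Fin n))
    (x : EuclideanSpace ℝ (Fin n)) : ℝ :=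
  ∑ i : Fin n, fderiv ℝ V x (EuclideanSpace.single i 1) i

lemma lip_of_grad {n : ℕ} (Φ : EuclideanSpace ℝ (Fin n) → EuclideanSpace ℝ (Fin n))
    (φ : EuclideanSpace ℝ (Fin n) → ℝ)
    (hΦ : ∀ x ∈ closedBall (0 : EuclideanSpace ℝ (Fin n)) 1, HasGradientAt φ (Φ x) x)
    (hΦc : ContinuousOn Φ (closedBall 0 1)) :
    ∃ C : ℝ≥0, LipschitzOnWith C φ (closedBall 0 1) := by
  obtain ⟨C, hC⟩ := (isCompact_closedBall (0 : EuclideanSpace ℝ (Fin n)) 1).exists_bound_of_continuousOn hΦc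
  refine ⟨C.toNNReal, (convex_closedBall _ _).lipschitzOnWith_of_nnnorm_hasFDerivWithin_le
    (fun x hx => (hΦ x hx).hasFDerivAt.hasFDerivWithinAt) fun x hx => ?_⟩
  rw [← NNReal.coe_le_coe, coe_nnnorm, LinearIsometryEquiv.norm_map]
  exact (hC x hx).trans (Real.le_coe_toNNReal C)

lemma green_ball {n : ℕ} (hn : 2 ≤ n)
    (V Φ : EuclideanSpace ℝ (Fin n) → EuclideanSpace ℝ (Fin n))
    (φ : EuclideanSpace ℝ (Fin n) → ℝ) {C : ℝ≥0} (hV : LipschitzOnWith C V (closedBall 0 1))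
    (hΦ : ∀ x ∈ closedBall (0 : EuclideanSpace ℝ (Fin n)) 1, HasGradientAt φ (Φ x) x)
    (hΦc : ContinuousOn Φ (closedBall 0 1)) :
    IntegrableOn (fun x => dvg V x * φ x) (ball 0 1) ∧
    ∫ x in ball (0 : EuclideanSpace ℝ (Fin n)) 1, inner ℝ (V x) (Φ x) =
      (∫ θ : sphere (0 : EuclideanSpace ℝ (Fin n)) 1, inner ℝ (V θ) (θ : EuclideanSpace ℝ (Fin n)) * φ θ
        ∂(volume : Measure (EuclideanSpace ℝ (Fin n))).toSphere) -
      ∫ x in ball (0 : EuclideanSpace ℝ (Fin n)) 1, dvg V x * φ x := by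
  have : Nonempty (Fin n) := ⟨⟨0, by omega⟩⟩
  have : Nontrivial (EuclideanSpace ℝ (Fin n)) := inferInstance
  set B := ball (0 : EuclideanSpace ℝ (Fin n)) 1
  obtain ⟨C', hφ⟩ := lip_of_grad Φ φ hΦ hΦc
  have hcomp := isCompact_closedBall (0 : EuclideanSpace ℝ (Fin n)) 1
  obtain ⟨M, hM⟩ := hcomp.exists_bound_of_continuousOn hV.continuousOn
  obtain ⟨M', hM'⟩ := hcomp.exists_bound_of_continuousOn hφ.continuousOn
  have hcoord : ∀ i, LipschitzOnWith C (fun x => V x i) (closedBall 0 1) := by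
    intro i
    refine LipschitzOnWith.of_dist_le_mul fun x hx y hy => ?_
    refine le_trans ?_ (hV.dist_le_mul x hx y hy)
    rw [Real.dist_eq, dist_eq_norm]
    have := PiLp.norm_apply_le (V x - V y) i
    simpa using this
  have hprod : ∀ i, ∃ K : ℝ≥0, LipschitzOnWith K (fun x => V x i * φ x) (closedBall 0 1) := by
    intro i
    refine ⟨(M * C' + M' * C).toNNReal, LipschitzOnWith.of_dist_le_mul fun x hx y hy => ?_⟩
    refine le_trans ?_ (mul_le_mul_of_nonneg_right (Real.le_coe_toNNReal _) dist_nonneg)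
    have h1 : |V x i| ≤ M := (by simpa using PiLp.norm_apply_le (V x) i : |V x i| ≤ ‖V x‖).trans (hM x hx)
    have h2 : |φ y| ≤ M' := hM' y hy
    have h3 := hφ.dist_le_mul x hx y hy
    have h4 := (hcoord i).dist_le_mul x hx y hy
    rw [Real.dist_eq] at *
    calc |V x i * φ x - V y i * φ y| = |V x i * (φ x - φ y) + φ y * (V x i - V y i)| := by
          congr 1; ring
      _ ≤ |V x i| * |φ x - φ y| + |φ y| * |V x i - V y i| := by
          rw [← abs_mul, ← abs_mul]; exact abs_add_le _ _
      _ ≤ M * (C' * dist x y) + M' * (C * dist x y) := by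
          have : 0 ≤ M := (abs_nonneg _).trans h1
          have : 0 ≤ M' := (abs_nonneg _).trans h2
          gcongr
      _ = _ := by ring
  choose K hK using hprod
  choose F hF hFeq using fun i => (hK i).extend_real
  have hae : ∀ᵐ x ∂volume.restrict B, DifferentiableAt ℝ V x := by
    rw [ae_restrict_iff' measurableSet_ball]
    filter_upwards [hV.ae_differentiableWithinAt_of_mem (μ := volume)] with x hx hxB
    exact (hx (ball_subset_closedBall hxB)).differentiableAt
      (mem_of_superset (isOpen_ball.mem_nhds hxB) ball_subset_closedBall)
  have hline : ∀ᵐ x ∂volume.restrict B, ∑ i, lineDeriv ℝ (F i) x (EuclideanSpace.single i 1)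
      = dvg V x * φ x + inner ℝ (V x) (Φ x) := by
    filter_upwards [hae, ae_restrict_mem measurableSet_ball] with x hx hxB
    have hxi : ∀ i, lineDeriv ℝ (F i) x (EuclideanSpace.single i 1) =
        fderiv ℝ V x (EuclideanSpace.single i 1) i * φ x + V x i * Φ x i := by
      intro i
      have heq : F i =ᶠ[𝓝 x] fun x => V x i * φ x := by
        filter_upwards [isOpen_ball.mem_nhds hxB] with y hy
        exact (hFeq i (ball_subset_closedBall hy)).symm
      rw [heq.lineDeriv_eq]
      have h1 : HasFDerivAt (fun x => V x i) ((EuclideanSpace.proj i : EuclideanSpace ℝ (Fin n) →L[ℝ] ℝ).comp (fderiv ℝ V x)) x :=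
        (EuclideanSpace.proj i : EuclideanSpace ℝ (Fin n) →L[ℝ] ℝ).hasFDerivAt.comp x hx.hasFDerivAt
      have h2 := (hΦ x (ball_subset_closedBall hxB)).hasFDerivAt
      have h3 := (h1.mul h2).hasLineDerivAt (EuclideanSpace.single i 1)
      refine h3.lineDeriv.trans ?_
      simp [EuclideanSpace.inner_single_right]
      ring
    rw [Finset.sum_congr rfl fun i _ => hxi i, Finset.sum_add_distrib, dvg, Finset.sum_mul]
    congr 1
    simp [PiLp.inner_apply, mul_comm]
  have hFint : ∀ i, IntegrableOn (fun x => lineDeriv ℝ (F i) x (EuclideanSpace.single i 1)) B := by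
    intro i
    refine Measure.integrableOn_of_bounded (M := K i * ‖(EuclideanSpace.single i 1 : EuclideanSpace ℝ (Fin n))‖) measure_ball_lt_top.ne
      (measurable_lineDeriv (hF i).continuous).aestronglyMeasurable
      (.of_forall fun x => norm_lineDeriv_le_of_lipschitz ℝ (hF i))
  have hsumint : IntegrableOn (fun x => ∑ i, lineDeriv ℝ (F i) x (EuclideanSpace.single i 1)) B :=
    integrable_finsetSum _ fun i _ => hFint i
  have hinner : IntegrableOn (fun x => inner ℝ (V x) (Φ x)) B :=
    ((hV.continuousOn.inner hΦc).integrableOn_compact hcomp).mono_set ball_subset_closedBall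
  have hdiv : IntegrableOn (fun x => dvg V x * φ x) B := by
    refine (hsumint.sub hinner).congr ?_
    filter_upwards [hline] with x hx
    simp [hx]
  refine ⟨hdiv, ?_⟩
  rw [eq_sub_iff_add_eq', ← integral_add hdiv hinner, ← integral_congr_ae hline,
    integral_finsetSum _ fun i _ => hFint i]
  rw [Finset.sum_congr rfl fun i _ => lip_div_ball volume (F i) (hF i) (EuclideanSpace.single i 1)]
  rw [← integral_finsetSum]
  · refine integral_congr_ae (.of_forall fun θ => ?_)
    simp only [PiLp.inner_apply, Finset.sum_mul]
    refine Finset.sum_congr rfl fun i _ => ?_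
    rw [← hFeq i (sphere_subset_closedBall θ.2)]
    simp [EuclideanSpace.inner_single_right, PiLp.single_apply]
    ring
  · intro i _
    refine Continuous.integrable_of_hasCompactSupport ?_ (HasCompactSupport.of_compactSpace _)
    have := (hF i).continuous
    fun_prop



lemma mono_of_quad (F : ℝ → ℝ) (a b C : ℝ) (hab : a ≤ b)
    (h : ∀ r s, a ≤ r → r ≤ s → s ≤ b → F r - C * (s - r) ^ 2 ≤ F s) : F a ≤ F b := by
  have key : ∀ N : ℕ, F a - C * (b - a) ^ 2 * (1 / ((N : ℝ) + 1)) ≤ F b := by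
    intro N
    set m : ℝ := (b - a) / (N + 1) with hm
    have hm0 : 0 ≤ m := div_nonneg (by linarith) (by positivity)
    have hmN : (N + 1) * m = b - a := by rw [hm]; field_simp
    have hind : ∀ k : ℕ, k ≤ N + 1 → F a - k * (C * m ^ 2) ≤ F (a + k * m) := by
      intro k
      induction k with
      | zero => simp
      | succ k ih =>
        intro hk
        have h1 := ih (by omega)
        have hk' : ((k : ℝ) + 1) ≤ N + 1 := by exact_mod_cast hk
        have h2 := h (a + k * m) (a + (k + 1) * m) (by nlinarith [mul_nonneg (Nat.cast_nonneg (α := ℝ) k) hm0])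
          (by nlinarith) (by nlinarith)
        have h3 : a + (k + 1) * m - (a + k * m) = m := by ring
        rw [h3] at h2
        push_cast
        linarith
    have h1 := hind (N + 1) le_rfl
    push_cast at h1
    rw [hmN] at h1
    have h2 : a + (b - a) = b := by ring
    rw [h2] at h1
    refine le_trans (le_of_eq ?_) h1
    rw [hm]; field_simp
  have hl : Tendsto (fun N : ℕ => F a - C * (b - a) ^ 2 * (1 / ((N : ℝ) + 1))) atTop
      (𝓝 (F a - C * (b - a) ^ 2 * 0)) :=
    tendsto_const_nhds.sub (tendsto_const_nhds.mul tendsto_one_div_add_atTop_nhds_zero_nat)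
  have := le_of_tendsto' hl key
  simpa using this

lemma taylor_alg (a b M L r s fr fs f1 : ℝ) (ha : 0 < a) (har : a ≤ r) (hrs : r ≤ s) (hsb : s ≤ b)
    (hfr : |fr| ≤ M) (hf1 : |f1| ≤ M) (he : |fs - fr - f1 * (s - r)| ≤ L * (s - r) ^ 2) :
    |fs / s ^ 2 - fr / r ^ 2 - (s - r) / r * (r⁻¹ * f1 - 2 * (fr / r ^ 2))|
      ≤ (L / a ^ 2 + M * (2 * b / a ^ 4) + M * (3 * b / a ^ 5)) * (s - r) ^ 2 := by
  have hr : 0 < r := by linarith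
  have hs : 0 < s := by linarith
  have hM : 0 ≤ M := (abs_nonneg _).trans hfr
  have hD : 0 ≤ s - r := by linarith
  have e1 : fs / s ^ 2 - fr / r ^ 2 - (s - r) / r * (r⁻¹ * f1 - 2 * (fr / r ^ 2)) =
      (fs - fr - f1 * (s - r)) / s ^ 2 + (-f1) * ((s + r) / (s ^ 2 * r ^ 2)) * (s - r) ^ 2
        + fr * ((2 * s + r) / (s ^ 2 * r ^ 3)) * (s - r) ^ 2 := by
    field_simp
    ring
  rw [e1]
  have b1 : |(fs - fr - f1 * (s - r)) / s ^ 2| ≤ L / a ^ 2 * (s - r) ^ 2 := by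
    rw [abs_div, abs_of_pos (by positivity : 0 < s ^ 2)]
    calc _ ≤ L * (s - r) ^ 2 / a ^ 2 := by
          have : 0 ≤ L * (s - r) ^ 2 := (abs_nonneg _).trans he
          have : a ≤ s := by linarith
          gcongr
      _ = _ := by ring
  have b2 : |(-f1) * ((s + r) / (s ^ 2 * r ^ 2)) * (s - r) ^ 2| ≤ M * (2 * b / a ^ 4) * (s - r) ^ 2 := by
    rw [abs_mul, abs_mul, abs_neg, abs_of_nonneg (by positivity : 0 ≤ (s - r) ^ 2),
      abs_of_nonneg (by positivity : 0 ≤ (s + r) / (s ^ 2 * r ^ 2))]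
    have : (s + r) / (s ^ 2 * r ^ 2) ≤ 2 * b / a ^ 4 := by
      rw [show a ^ 4 = a ^ 2 * a ^ 2 by ring]
      have : a ≤ s := by linarith
      gcongr
      · linarith
      · linarith
    gcongr
  have b3 : |fr * ((2 * s + r) / (s ^ 2 * r ^ 3)) * (s - r) ^ 2| ≤ M * (3 * b / a ^ 5) * (s - r) ^ 2 := by
    rw [abs_mul, abs_mul, abs_of_nonneg (by positivity : 0 ≤ (s - r) ^ 2),
      abs_of_nonneg (by positivity : 0 ≤ (2 * s + r) / (s ^ 2 * r ^ 3))]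
    have : (2 * s + r) / (s ^ 2 * r ^ 3) ≤ 3 * b / a ^ 5 := by
      rw [show a ^ 5 = a ^ 2 * a ^ 3 by ring]
      have : a ≤ s := by linarith
      gcongr
      · linarith
      · linarith
    gcongr
  have := abs_add_three ((fs - fr - f1 * (s - r)) / s ^ 2) ((-f1) * ((s + r) / (s ^ 2 * r ^ 2)) * (s - r) ^ 2) (fr * ((2 * s + r) / (s ^ 2 * r ^ 3)) * (s - r) ^ 2)
  linarith

/-- Data of a quadratic polynomial with trace one. -/
structure QData {n : ℕ} (T : EuclideanSpace ℝ (Fin n) →L[ℝ] EuclideanSpace ℝ (Fin n))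
    (p : EuclideanSpace ℝ (Fin n) → ℝ) : Prop where
  grad : ∀ x, HasGradientAt p (T x) x
  div : ∀ x, dvg T x = 1
  hom : ∀ x, inner ℝ (T x) x = 2 * p x
  nonneg : ∀ x, 0 ≤ p x

/-- Data of a solution. -/
structure UData {n : ℕ} (u : EuclideanSpace ℝ (Fin n) → ℝ)
    (G : EuclideanSpace ℝ (Fin n) → EuclideanSpace ℝ (Fin n)) (ρ : ℝ) : Prop where
  hn : 2 ≤ n
  grad : ∀ x ∈ ball (0 : EuclideanSpace ℝ (Fin n)) ρ, HasGradientAt u (G x) x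
  lip : ∀ b < ρ, ∃ L : ℝ≥0, LipschitzOnWith L G (closedBall 0 b)
  nonneg : ∀ x ∈ ball (0 : EuclideanSpace ℝ (Fin n)) ρ, 0 ≤ u x
  lap : ∀ᵐ x, x ∈ ball (0 : EuclideanSpace ℝ (Fin n)) ρ → dvg G x = if 0 < u x then 1 else 0

/-- rescaled difference -/
def wf {n : ℕ} (u p : EuclideanSpace ℝ (Fin n) → ℝ) (r : ℝ) (x : EuclideanSpace ℝ (Fin n)) : ℝ :=
  u (r • x) / r ^ 2 - p x

/-- its gradient -/
def Vf {n : ℕ} (G : EuclideanSpace ℝ (Fin n) → EuclideanSpace ℝ (Fin n))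
    (T : EuclideanSpace ℝ (Fin n) →L[ℝ] EuclideanSpace ℝ (Fin n))
    (r : ℝ) (x : EuclideanSpace ℝ (Fin n)) : EuclideanSpace ℝ (Fin n) :=
  r⁻¹ • G (r • x) - T x

/-- radial defect -/
def Zf {n : ℕ} (u : EuclideanSpace ℝ (Fin n) → ℝ)
    (G : EuclideanSpace ℝ (Fin n) → EuclideanSpace ℝ (Fin n))
    (r : ℝ) (x : EuclideanSpace ℝ (Fin n)) : ℝ :=
  r⁻¹ * inner ℝ (G (r • x)) x - 2 * (u (r • x) / r ^ 2)

section
variable {n : ℕ} {u p : EuclideanSpace ℝ (Fin n) → ℝ}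
  {G : EuclideanSpace ℝ (Fin n) → EuclideanSpace ℝ (Fin n)}
  {T : EuclideanSpace ℝ (Fin n) →L[ℝ] EuclideanSpace ℝ (Fin n)} {ρ : ℝ}

lemma Zf_eq (hq : QData T p) (r : ℝ) (x : EuclideanSpace ℝ (Fin n)) :
    inner ℝ (Vf G T r x) x - 2 * wf u p r x = Zf u G r x := by
  simp only [Vf, wf, Zf, inner_sub_left, inner_smul_left, hq.hom, conj_trivial]
  ring

lemma smul_mem_cb {r b : ℝ} (hr : 0 ≤ r) (hb : r ≤ b) {x : EuclideanSpace ℝ (Fin n)}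
    (hx : x ∈ closedBall (0 : EuclideanSpace ℝ (Fin n)) 1) : r • x ∈ closedBall (0 : EuclideanSpace ℝ (Fin n)) b := by
  rw [mem_closedBall_zero_iff] at *
  rw [norm_smul, Real.norm_of_nonneg hr]
  nlinarith

lemma smul_mem_b {r : ℝ} (hr : 0 ≤ r) (hb : r < ρ) {x : EuclideanSpace ℝ (Fin n)}
    (hx : x ∈ closedBall (0 : EuclideanSpace ℝ (Fin n)) 1) : r • x ∈ ball (0 : EuclideanSpace ℝ (Fin n)) ρ := 
  closedBall_subset_ball hb (smul_mem_cb hr le_rfl hx)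

lemma wf_grad (hU : UData u G ρ) (hq : QData T p) {r : ℝ} (hr : 0 < r) (hrρ : r < ρ)
    (x : EuclideanSpace ℝ (Fin n)) (hx : x ∈ closedBall (0 : EuclideanSpace ℝ (Fin n)) 1) :
    HasGradientAt (wf u p r) (Vf G T r x) x := by
  have h1 := (hU.grad _ (smul_mem_b hr.le hrρ hx)).hasFDerivAt
  have h2 : HasFDerivAt (fun x : EuclideanSpace ℝ (Fin n) => r • x) (r • ContinuousLinearMap.id ℝ _) x :=
    (hasFDerivAt_id x).const_smul r
  have h3 := ((h1.comp x h2).const_mul (r ^ 2)⁻¹).sub (hq.grad x).hasFDerivAt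
  rw [hasGradientAt_iff_hasFDerivAt]
  refine (h3.congr_fderiv ?_).congr_of_eventuallyEq (.of_forall fun y => ?_)
  · ext y
    simp [Vf]
    field_simp
  · simp [wf]; ring

lemma Vf_lip (hU : UData u G ρ) (T : EuclideanSpace ℝ (Fin n) →L[ℝ] EuclideanSpace ℝ (Fin n))
    {r : ℝ} (hr : 0 < r) (hrρ : r < ρ) :
    ∃ C : ℝ≥0, LipschitzOnWith C (Vf G T r) (closedBall 0 1) := by
  obtain ⟨L, hL⟩ := hU.lip r hrρ
  have h1 : LipschitzOnWith (L * ‖r‖₊) (fun x : EuclideanSpace ℝ (Fin n) => G (r • x)) (closedBall 0 1) :=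
    hL.comp ((lipschitzWith_smul r).lipschitzOnWith) fun x hx => smul_mem_cb hr.le le_rfl hx
  have h2 : LipschitzOnWith (‖r⁻¹‖₊ * (L * ‖r‖₊)) (fun x : EuclideanSpace ℝ (Fin n) => r⁻¹ • G (r • x)) (closedBall 0 1) :=
    (lipschitzWith_smul r⁻¹).comp_lipschitzOnWith h1
  exact ⟨_, h2.sub (T.lipschitz.lipschitzOnWith)⟩

lemma wf_cont (hU : UData u G ρ) (hq : QData T p) {r : ℝ} (hr : 0 < r) (hrρ : r < ρ) :
    ContinuousOn (wf u p r) (closedBall 0 1) := fun x hx =>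
  (wf_grad hU hq hr hrρ x hx).continuousAt.continuousWithinAt

lemma wf_conts (hU : UData u G ρ) (hq : QData T p) {r : ℝ} (hr : 0 < r) (hrρ : r < ρ) :
    Continuous (fun θ : sphere (0 : EuclideanSpace ℝ (Fin n)) 1 => wf u p r θ) :=
  (wf_cont hU hq hr hrρ).comp_continuous continuous_subtype_val fun θ => sphere_subset_closedBall θ.2

lemma Vf_conts (hU : UData u G ρ) (T : EuclideanSpace ℝ (Fin n) →L[ℝ] EuclideanSpace ℝ (Fin n))
    {r : ℝ} (hr : 0 < r) (hrρ : r < ρ) :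
    Continuous (fun θ : sphere (0 : EuclideanSpace ℝ (Fin n)) 1 => Vf G T r θ) := by
  obtain ⟨C, hC⟩ := Vf_lip hU T hr hrρ
  exact hC.continuousOn.comp_continuous continuous_subtype_val fun θ => sphere_subset_closedBall θ.2

lemma Zf_conts (hU : UData u G ρ) (hq : QData T p) {r : ℝ} (hr : 0 < r) (hrρ : r < ρ) :
    Continuous (fun θ : sphere (0 : EuclideanSpace ℝ (Fin n)) 1 => Zf u G r θ) := by
  simp only [← Zf_eq hq]
  have := wf_conts hU hq hr hrρ
  have := Vf_conts hU T hr hrρ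
  fun_prop

lemma sph_int {f : sphere (0 : EuclideanSpace ℝ (Fin n)) 1 → ℝ} (hf : Continuous f) :
    Integrable f (volume : Measure (EuclideanSpace ℝ (Fin n))).toSphere :=
  hf.integrable_of_hasCompactSupport (HasCompactSupport.of_compactSpace _)

lemma Vf_div (hU : UData u G ρ) (hq : QData T p) {r : ℝ} (hr : 0 < r) (hrρ : r < ρ) :
    ∀ᵐ x ∂volume.restrict (ball (0 : EuclideanSpace ℝ (Fin n)) 1),
      dvg (Vf G T r) x = if 0 < u (r • x) then 0 else -1 := by
  rw [ae_restrict_iff' measurableSet_ball]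
  have hscale : ∀ᵐ x : EuclideanSpace ℝ (Fin n), r • x ∈ ball (0 : EuclideanSpace ℝ (Fin n)) ρ → dvg G (r • x) = if 0 < u (r • x) then 1 else 0 := by
    have h := hU.lap
    rw [ae_iff] at h ⊢
    have := Measure.addHaar_preimage_smul (volume : Measure (EuclideanSpace ℝ (Fin n))) hr.ne' _ |>.trans (by rw [h, mul_zero])
    exact this
  obtain ⟨L, hL⟩ := hU.lip r hrρ
  have h1 : LipschitzOnWith (L * ‖r‖₊) (fun x : EuclideanSpace ℝ (Fin n) => G (r • x)) (closedBall 0 1) :=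
    hL.comp ((lipschitzWith_smul r).lipschitzOnWith) fun x hx => smul_mem_cb hr.le le_rfl hx
  filter_upwards [hscale, h1.ae_differentiableWithinAt_of_mem (μ := volume)] with x hx hd hxB
  have hxc := ball_subset_closedBall hxB
  have hd' : DifferentiableAt ℝ (fun x : EuclideanSpace ℝ (Fin n) => G (r • x)) x := (hd hxc).differentiableAt
      (mem_of_superset (isOpen_ball.mem_nhds hxB) ball_subset_closedBall)
  have hx' := hx (smul_mem_b hr.le hrρ hxc)
  have hf : fderiv ℝ (Vf G T r) x = fderiv ℝ G (r • x) - T := by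
    have e1 : fderiv ℝ (fun x : EuclideanSpace ℝ (Fin n) => G (r • x)) x = r • fderiv ℝ G (r • x) := fderiv_comp_smul _
    have e2 := (hd'.hasFDerivAt.const_smul r⁻¹).sub T.hasFDerivAt
    rw [e1, smul_smul, inv_mul_cancel₀ hr.ne', one_smul] at e2
    exact e2.fderiv
  have hT := hq.div x
  have : dvg (Vf G T r) x = dvg G (r • x) - dvg T x := by
    simp only [dvg, hf, T.fderiv, ← Finset.sum_sub_distrib]
    rfl
  rw [this, hT, hx']
  split_ifs <;> norm_num

end


section
variable {n : ℕ} {u p : EuclideanSpace ℝ (Fin n) → ℝ}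
  {G : EuclideanSpace ℝ (Fin n) → EuclideanSpace ℝ (Fin n)}
  {T : EuclideanSpace ℝ (Fin n) →L[ℝ] EuclideanSpace ℝ (Fin n)} {ρ : ℝ}

lemma taylor_unif (hU : UData u G ρ) (hq : QData T p) {a b : ℝ} (ha : 0 < a) (hb : b < ρ) :
    ∃ C : ℝ, 0 ≤ C ∧ ∀ θ : sphere (0 : EuclideanSpace ℝ (Fin n)) 1, ∀ r s, a ≤ r → r ≤ s → s ≤ b →
      |wf u p s θ - wf u p r θ - (s - r) / r * Zf u G r θ| ≤ C * (s - r) ^ 2 ∧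
      |Zf u G r θ| ≤ C ∧ |wf u p r θ| ≤ C := by
  obtain ⟨L, hL⟩ := hU.lip b hb
  have hcomp := isCompact_closedBall (0 : EuclideanSpace ℝ (Fin n)) b
  have huc : ContinuousOn u (closedBall 0 b) := fun x hx =>
    (hU.grad x (closedBall_subset_ball hb hx)).continuousAt.continuousWithinAt
  obtain ⟨M1, hM1⟩ := hcomp.exists_bound_of_continuousOn huc
  obtain ⟨M2, hM2⟩ := hcomp.exists_bound_of_continuousOn hL.continuousOn
  have hpc : Continuous p := continuous_iff_continuousAt.2 fun x => (hq.grad x).continuousAt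
  obtain ⟨M3, hM3⟩ := (isCompact_sphere (0 : EuclideanSpace ℝ (Fin n)) 1).exists_bound_of_continuousOn hpc.continuousOn
  set M := max (max M1 M2) 0
  have hM0 : 0 ≤ M := le_max_right _ _
  set C1 := (L / a ^ 2 + M * (2 * |b| / a ^ 4) + M * (3 * |b| / a ^ 5))
  set C2 := a⁻¹ * M + 2 * (M / a ^ 2)
  set C3 := M / a ^ 2 + |M3|
  have hC1 : 0 ≤ C1 := by positivity
  have hC2 : 0 ≤ C2 := by positivity
  have hC3 : 0 ≤ C3 := by positivity
  refine ⟨C1 + C2 + C3, by positivity, fun θ r s har hrs hsb => ?_⟩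
  have hθ : ‖(θ : EuclideanSpace ℝ (Fin n))‖ = 1 := norm_eq_of_mem_sphere θ
  have hmem : ∀ t, a ≤ t → t ≤ b → t • (θ : EuclideanSpace ℝ (Fin n)) ∈ closedBall (0 : EuclideanSpace ℝ (Fin n)) b :=
    fun t h1 h2 => smul_mem_cb (by linarith) h2 (sphere_subset_closedBall θ.2)
  have hr : 0 < r := by linarith
  have hb0 : 0 < b := by linarith
  have hub : ∀ t, a ≤ t → t ≤ b → |u (t • (θ : EuclideanSpace ℝ (Fin n)))| ≤ M := fun t h1 h2 =>
    (hM1 _ (hmem t h1 h2)).trans ((le_max_left _ _).trans (le_max_left _ _))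
  have hGb : ∀ t, a ≤ t → t ≤ b → |inner ℝ (G (t • (θ : EuclideanSpace ℝ (Fin n)))) (θ : EuclideanSpace ℝ (Fin n))| ≤ M := fun t h1 h2 => by
    refine (abs_real_inner_le_norm _ _).trans ?_
    rw [hθ, mul_one]
    exact (hM2 _ (hmem t h1 h2)).trans ((le_max_right _ _).trans (le_max_left _ _))
  have hder : ∀ t, a ≤ t → t ≤ b → HasDerivAt (fun t : ℝ => u (t • (θ : EuclideanSpace ℝ (Fin n))))
      (inner ℝ (G (t • (θ : EuclideanSpace ℝ (Fin n)))) (θ : EuclideanSpace ℝ (Fin n))) t := by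
    intro t h1 h2
    have e1 := (hU.grad _ (closedBall_subset_ball hb (hmem t h1 h2))).hasFDerivAt
    have e2 : HasDerivAt (fun t : ℝ => t • (θ : EuclideanSpace ℝ (Fin n))) (θ : EuclideanSpace ℝ (Fin n)) t := by
      simpa using (hasDerivAt_id t).smul_const (θ : EuclideanSpace ℝ (Fin n))
    have h := e1.comp_hasDerivAt t e2
    exact h
  set f1 := inner ℝ (G (r • (θ : EuclideanSpace ℝ (Fin n)))) (θ : EuclideanSpace ℝ (Fin n)) with hf1
  have htay : |u (s • (θ : EuclideanSpace ℝ (Fin n))) - u (r • (θ : EuclideanSpace ℝ (Fin n))) - f1 * (s - r)| ≤ L * (s - r) ^ 2 := by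
    have := norm_image_sub_le_of_norm_deriv_le_segment' (a := r) (b := s)
      (f := fun t : ℝ => u (t • (θ : EuclideanSpace ℝ (Fin n))) - f1 * t)
      (f' := fun t => inner ℝ (G (t • (θ : EuclideanSpace ℝ (Fin n)))) (θ : EuclideanSpace ℝ (Fin n)) - f1)
      (C := L * (s - r)) (fun t ht => by
        have := (hder t (by linarith [ht.1]) (by linarith [ht.2])).sub ((hasDerivAt_id t).const_mul f1)
        rw [mul_one] at this
        exact this.hasDerivWithinAt) (fun t ht => by
        rw [hf1, ← inner_sub_left]
        refine (norm_inner_le_norm _ _).trans ?_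
        rw [hθ, mul_one, ← dist_eq_norm]
        refine (hL.dist_le_mul _ (hmem t (by linarith [ht.1]) (by linarith [ht.2])) _ (hmem r har (by linarith))).trans ?_
        rw [dist_eq_norm, ← sub_smul, norm_smul, hθ, mul_one, Real.norm_of_nonneg (by linarith [ht.1])]
        gcongr
        exact ht.2.le) s ⟨hrs, le_rfl⟩
    rw [Real.norm_eq_abs] at this
    calc _ = |u (s • (θ : EuclideanSpace ℝ (Fin n))) - f1 * s - (u (r • (θ : EuclideanSpace ℝ (Fin n))) - f1 * r)| := by
          congr 1; ring
      _ ≤ _ := this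
      _ = _ := by ring
  have h1 := taylor_alg a b M L r s _ _ f1 ha har hrs hsb (hub r har (by linarith)) (hGb r har (by linarith)) htay
  have hu2 : |u (r • (θ : EuclideanSpace ℝ (Fin n))) / r ^ 2| ≤ M / a ^ 2 := by
    rw [abs_div, abs_of_pos (by positivity : 0 < r ^ 2)]
    have := hub r har (by linarith)
    gcongr
  refine ⟨?_, ?_, ?_⟩
  · have : wf u p s θ - wf u p r θ - (s - r) / r * Zf u G r θ =
      u (s • (θ : EuclideanSpace ℝ (Fin n))) / s ^ 2 - u (r • (θ : EuclideanSpace ℝ (Fin n))) / r ^ 2 -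
        (s - r) / r * (r⁻¹ * f1 - 2 * (u (r • (θ : EuclideanSpace ℝ (Fin n))) / r ^ 2)) := by
      simp only [wf, Zf, hf1]; ring
    rw [this]
    refine h1.trans ?_
    rw [← abs_of_pos hb0]
    refine mul_le_mul_of_nonneg_right (by simp only [C1] at *; linarith) (sq_nonneg _)
  · have e : |Zf u G r θ| ≤ C2 := by
      refine (abs_sub _ _).trans ?_
      rw [abs_mul, abs_mul, abs_of_pos (by positivity : 0 < r⁻¹), abs_two]
      have := hGb r har (by linarith)
      have h9 : 2 * |u (r • (θ : EuclideanSpace ℝ (Fin n))) / r ^ 2| ≤ 2 * (M / a ^ 2) := by linarith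
      have h10 : r⁻¹ ≤ a⁻¹ := inv_anti₀ ha har
      exact add_le_add (mul_le_mul h10 this (abs_nonneg _) (by positivity)) h9
    linarith
  · have e : |wf u p r θ| ≤ C3 := by
      refine (abs_sub _ _).trans ?_
      have : |p θ| ≤ |M3| := (hM3 θ θ.2).trans (le_abs_self _)
      linarith
    linarith

/-- The Weiss-type energy. -/
def Wf (u p : EuclideanSpace ℝ (Fin n) → ℝ)
    (G : EuclideanSpace ℝ (Fin n) → EuclideanSpace ℝ (Fin n))
    (T : EuclideanSpace ℝ (Fin n) →L[ℝ] EuclideanSpace ℝ (Fin n)) (r : ℝ) : ℝ :=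
  (1 / 2) * (∫ x in ball (0 : EuclideanSpace ℝ (Fin n)) 1, inner ℝ (Vf G T r x) (Vf G T r x)) -
    ∫ θ : sphere (0 : EuclideanSpace ℝ (Fin n)) 1, wf u p r θ ^ 2
        ∂(volume : Measure (EuclideanSpace ℝ (Fin n))).toSphere

/-- The Monneau quantity. -/
def Hf (u p : EuclideanSpace ℝ (Fin n) → ℝ) (r : ℝ) : ℝ :=
  ∫ θ : sphere (0 : EuclideanSpace ℝ (Fin n)) 1, wf u p r θ ^ 2
        ∂(volume : Measure (EuclideanSpace ℝ (Fin n))).toSphere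

lemma inner_int {V Φ : EuclideanSpace ℝ (Fin n) → EuclideanSpace ℝ (Fin n)}
    (hV : ContinuousOn V (closedBall 0 1)) (hΦ : ContinuousOn Φ (closedBall 0 1)) :
    IntegrableOn (fun x => inner ℝ (V x) (Φ x)) (ball (0 : EuclideanSpace ℝ (Fin n)) 1) :=
  ((hV.inner hΦ).integrableOn_compact (isCompact_closedBall _ _)).mono_set ball_subset_closedBall

lemma inner_expand {V V' : EuclideanSpace ℝ (Fin n) → EuclideanSpace ℝ (Fin n)}
    (hV : ContinuousOn V (closedBall 0 1)) (hV' : ContinuousOn V' (closedBall 0 1)) :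
    (∫ x in ball (0 : EuclideanSpace ℝ (Fin n)) 1, inner ℝ (V x) (V x)) +
      2 * (∫ x in ball (0 : EuclideanSpace ℝ (Fin n)) 1, inner ℝ (V x) (V' x - V x)) ≤
    ∫ x in ball (0 : EuclideanSpace ℝ (Fin n)) 1, inner ℝ (V' x) (V' x) := by
  have hd : ContinuousOn (fun x => V' x - V x) (closedBall 0 1) := hV'.sub hV
  rw [← integral_const_mul, ← integral_add (inner_int hV hV) ((inner_int hV hd).const_mul 2)]
  refine integral_mono ((inner_int hV hV).add ((inner_int hV hd).const_mul 2)) (inner_int hV' hV') fun x => ?_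
  have : 0 ≤ inner ℝ (V' x - V x) (V' x - V x) := real_inner_self_nonneg
  simp only [inner_sub_left, inner_sub_right, real_inner_comm (V x) (V' x)] at *
  linarith

lemma weiss_step (hU : UData u G ρ) (hq : QData T p) {r s : ℝ} (hr : 0 < r) (hrs : r ≤ s) (hs : s < ρ) :
    Wf u p G T r + ∫ θ : sphere (0 : EuclideanSpace ℝ (Fin n)) 1,
      (wf u p s θ - wf u p r θ) * (Zf u G r θ - (wf u p s θ - wf u p r θ))
        ∂(volume : Measure (EuclideanSpace ℝ (Fin n))).toSphere ≤ Wf u p G T s := by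
  have hs0 : 0 < s := by linarith
  have hrρ : r < ρ := by linarith
  obtain ⟨C, hC⟩ := Vf_lip hU T hr hrρ
  obtain ⟨C', hC'⟩ := Vf_lip hU T hs0 hs
  obtain ⟨g1, g2⟩ := green_ball hU.hn (Vf G T r) (fun x => Vf G T s x - Vf G T r x)
    (fun x => wf u p s x - wf u p r x) hC
    (fun x hx => by
      have := (wf_grad hU hq hs0 hs x hx).hasFDerivAt.sub (wf_grad hU hq hr hrρ x hx).hasFDerivAt
      rw [hasGradientAt_iff_hasFDerivAt, map_sub]
      exact this) (hC'.continuousOn.sub hC.continuousOn)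
  have hsign : ∫ x in ball (0 : EuclideanSpace ℝ (Fin n)) 1, dvg (Vf G T r) x * (wf u p s x - wf u p r x) ≤ 0 := by
    apply integral_nonpos_of_ae
    filter_upwards [Vf_div hU hq hr hrρ, ae_restrict_mem measurableSet_ball] with x hx hxB
    have hxc := ball_subset_closedBall hxB
    simp only [hx, Pi.zero_apply]
    split_ifs with h
    · simp
    · have h1 : u (r • x) = 0 := le_antisymm (not_lt.1 h) (hU.nonneg _ (smul_mem_b hr.le hrρ hxc))
      have h2 := hU.nonneg _ (smul_mem_b hs0.le hs hxc)
      simp only [wf, h1, zero_div]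
      have : 0 ≤ u (s • x) / s ^ 2 := by positivity
      linarith
  have hexp := inner_expand hC.continuousOn hC'.continuousOn
  have cw := wf_conts hU hq hr hrρ
  have cw' := wf_conts hU hq hs0 hs
  have cV := Vf_conts hU T hr hrρ
  have cZ := Zf_conts hU hq hr hrρ
  have hS : (∫ θ : sphere (0 : EuclideanSpace ℝ (Fin n)) 1,
      (wf u p s θ - wf u p r θ) * (Zf u G r θ - (wf u p s θ - wf u p r θ))
        ∂(volume : Measure (EuclideanSpace ℝ (Fin n))).toSphere) =
      (∫ θ : sphere (0 : EuclideanSpace ℝ (Fin n)) 1, inner ℝ (Vf G T r θ) (θ : EuclideanSpace ℝ (Fin n)) * (wf u p s θ - wf u p r θ)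
        ∂(volume : Measure (EuclideanSpace ℝ (Fin n))).toSphere) +
      (∫ θ : sphere (0 : EuclideanSpace ℝ (Fin n)) 1, wf u p r θ ^ 2
        ∂(volume : Measure (EuclideanSpace ℝ (Fin n))).toSphere) -
      ∫ θ : sphere (0 : EuclideanSpace ℝ (Fin n)) 1, wf u p s θ ^ 2
        ∂(volume : Measure (EuclideanSpace ℝ (Fin n))).toSphere := by
    rw [← integral_add (sph_int (by fun_prop)) (sph_int (by fun_prop)),
      ← integral_sub (sph_int (by fun_prop)) (sph_int (by fun_prop))]
    refine integral_congr_ae (.of_forall fun θ => ?_)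
    simp only [← Zf_eq (u := u) (G := G) hq]
    ring
  rw [hS]
  simp only [Wf]
  rw [g2] at hexp
  linarith

lemma sph_mono_const {f : sphere (0 : EuclideanSpace ℝ (Fin n)) 1 → ℝ} (hf : Continuous f) (K : ℝ)
    (h : ∀ θ, K ≤ f θ) : K * (volume : Measure (EuclideanSpace ℝ (Fin n))).toSphere.real univ ≤
      ∫ θ, f θ ∂(volume : Measure (EuclideanSpace ℝ (Fin n))).toSphere := by
  have := integral_mono (integrable_const (μ := (volume : Measure (EuclideanSpace ℝ (Fin n))).toSphere) K) (sph_int hf) h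
  rw [integral_const, smul_eq_mul, mul_comm] at this
  exact this

lemma weiss_mono (hU : UData u G ρ) (hq : QData T p) {a b : ℝ} (ha : 0 < a) (hab : a ≤ b) (hb : b < ρ) :
    Wf u p G T a ≤ Wf u p G T b := by
  obtain ⟨C, hC0, hC⟩ := taylor_unif hU hq ha hb
  set K := C ^ 2 + (C / a + C * b) ^ 2
  refine mono_of_quad _ a b (K * (volume : Measure (EuclideanSpace ℝ (Fin n))).toSphere.real univ) hab ?_
  intro r s har hrs hsb
  have hr : 0 < r := by linarith
  have hs : 0 < s := by linarith
  refine le_trans ?_ (weiss_step hU hq hr hrs (by linarith))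
  have cw := wf_conts hU hq hr (by linarith)
  have cw' := wf_conts hU hq hs (by linarith)
  have cZ := Zf_conts hU hq hr (by linarith)
  have := sph_mono_const (n := n) (f := fun θ => (wf u p s θ - wf u p r θ) * (Zf u G r θ - (wf u p s θ - wf u p r θ)))
    (by fun_prop) (-(K * (s - r) ^ 2)) (fun θ => by
      obtain ⟨h1, h2, -⟩ := hC θ r s har hrs hsb
      set d := wf u p s θ - wf u p r θ
      set Z := Zf u G r θ
      set D := s - r
      have hD : 0 ≤ D := by simp only [D]; linarith
      have hDb : D ≤ b := by simp only [D]; linarith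
      set e := d - D / r * Z with he
      have hd : d = D / r * Z + e := by rw [he]; ring
      have hDr : 0 ≤ D / r := by positivity
      have hDa : D / r ≤ D / a := by gcongr
      have h3 : |e * Z| ≤ C * D ^ 2 * C := by rw [abs_mul]; gcongr
      have h4 : |d| ≤ (C / a + C * b) * D := by
        rw [hd]
        refine (abs_add_le _ _).trans ?_
        rw [abs_mul, abs_of_nonneg hDr]
        calc D / r * |Z| + |e| ≤ D / a * C + C * D ^ 2 := by gcongr
          _ ≤ D / a * C + C * (b * D) := by
            gcongr
            nlinarith
          _ = _ := by ring
      have h5 : d ^ 2 ≤ ((C / a + C * b) * D) ^ 2 := by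
        rw [← sq_abs d]; gcongr
      have h6 : d * Z = D / r * Z ^ 2 + e * Z := by rw [hd]; ring
      have h7 : 0 ≤ D / r * Z ^ 2 := by positivity
      have h8 := (abs_le.1 h3).1
      have : d * (Z - d) = d * Z - d ^ 2 := by ring
      rw [this, h6]
      simp only [K]
      nlinarith)
  linarith

lemma weiss_lower (hU : UData u G ρ) (hq : QData T p)
    {T0 : EuclideanSpace ℝ (Fin n) →L[ℝ] EuclideanSpace ℝ (Fin n)} {p0 : EuclideanSpace ℝ (Fin n) → ℝ}
    (hq0 : QData T0 p0) {r : ℝ} (hr : 0 < r) (hrρ : r < ρ) :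
    -(∫ θ : sphere (0 : EuclideanSpace ℝ (Fin n)) 1, wf u p0 r θ ^ 2
        ∂(volume : Measure (EuclideanSpace ℝ (Fin n))).toSphere) ≤ Wf u p G T r := by
  obtain ⟨C, hC⟩ := Vf_lip hU T hr hrρ
  obtain ⟨C', hC'⟩ := Vf_lip hU T0 hr hrρ
  have hQ : LipschitzOnWith _ (fun x => (T0 - T) x) (closedBall (0 : EuclideanSpace ℝ (Fin n)) 1) :=
    (T0 - T).lipschitz.lipschitzOnWith
  have hdiv : ∀ x, dvg (fun x => (T0 - T) x) x = 0 := by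
    intro x
    have h1 := hq0.div x
    have h2 := hq.div x
    simp only [dvg, ContinuousLinearMap.fderiv] at *
    simp [Finset.sum_sub_distrib, h1, h2]
  obtain ⟨-, g1⟩ := green_ball hU.hn (fun x => (T0 - T) x) (fun x => Vf G T0 r x) (wf u p0 r) hQ
    (fun x hx => wf_grad hU hq0 hr hrρ x hx) hC'.continuousOn
  obtain ⟨-, g2⟩ := green_ball hU.hn (fun x => (T0 - T) x) (fun x => (T0 - T) x) (fun x => p0 x - p x) hQ
    (fun x hx => by
      have := (hq0.grad x).hasFDerivAt.sub (hq.grad x).hasFDerivAt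
      rw [hasGradientAt_iff_hasFDerivAt, _root_.sub_apply, map_sub]
      exact this) hQ.continuousOn
  simp only [hdiv, zero_mul, integral_zero, sub_zero] at g1 g2
  have hexp := inner_expand hQ.continuousOn hC.continuousOn
  have hV : ∀ x, Vf G T r x - (T0 - T) x = Vf G T0 r x := by
    intro x; simp [Vf]
  simp only [hV] at hexp
  rw [g1, g2] at hexp
  have hpc : Continuous p := continuous_iff_continuousAt.2 fun x => (hq.grad x).continuousAt
  have hpc0 : Continuous p0 := continuous_iff_continuousAt.2 fun x => (hq0.grad x).continuousAt
  have cw := wf_conts hU hq hr hrρ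
  have cw0 := wf_conts hU hq0 hr hrρ
  have hin : ∀ x, inner ℝ ((T0 - T) x) x = 2 * (p0 x - p x) := by
    intro x
    simp [inner_sub_left, hq.hom, hq0.hom]; ring
  simp only [hin] at hexp
  have hS : (∫ θ : sphere (0 : EuclideanSpace ℝ (Fin n)) 1, wf u p r θ ^ 2
        ∂(volume : Measure (EuclideanSpace ℝ (Fin n))).toSphere) =
      (∫ θ : sphere (0 : EuclideanSpace ℝ (Fin n)) 1, wf u p0 r θ ^ 2
        ∂(volume : Measure (EuclideanSpace ℝ (Fin n))).toSphere) +
      (∫ θ : sphere (0 : EuclideanSpace ℝ (Fin n)) 1, 2 * (p0 θ - p θ) * wf u p0 r θ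
        ∂(volume : Measure (EuclideanSpace ℝ (Fin n))).toSphere) +
      (1 / 2) * (∫ θ : sphere (0 : EuclideanSpace ℝ (Fin n)) 1, 2 * (p0 θ - p θ) * (p0 θ - p θ)
        ∂(volume : Measure (EuclideanSpace ℝ (Fin n))).toSphere) := by
    rw [← integral_const_mul, ← integral_add (sph_int (by fun_prop)) (sph_int (by fun_prop)),
      ← integral_add (sph_int (by fun_prop)) (sph_int (by fun_prop))]
    refine integral_congr_ae (.of_forall fun θ => ?_)
    simp only [wf]
    ring
  simp only [Wf]
  rw [hS]
  linarith

lemma N_nonneg (hU : UData u G ρ) (hq : QData T p) {r : ℝ} (hr : 0 < r) (hrρ : r < ρ)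
    (hW : 0 ≤ Wf u p G T r) :
    0 ≤ ∫ θ : sphere (0 : EuclideanSpace ℝ (Fin n)) 1, wf u p r θ * Zf u G r θ
        ∂(volume : Measure (EuclideanSpace ℝ (Fin n))).toSphere := by
  obtain ⟨C, hC⟩ := Vf_lip hU T hr hrρ
  obtain ⟨-, g⟩ := green_ball hU.hn (Vf G T r) (Vf G T r) (wf u p r) hC
    (fun x hx => wf_grad hU hq hr hrρ x hx) hC.continuousOn
  have hsign : 0 ≤ ∫ x in ball (0 : EuclideanSpace ℝ (Fin n)) 1, dvg (Vf G T r) x * wf u p r x := by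
    apply integral_nonneg_of_ae
    filter_upwards [Vf_div hU hq hr hrρ, ae_restrict_mem measurableSet_ball] with x hx hxB
    have hxc := ball_subset_closedBall hxB
    simp only [hx, Pi.zero_apply]
    split_ifs with h
    · simp
    · have h1 : u (r • x) = 0 := le_antisymm (not_lt.1 h) (hU.nonneg _ (smul_mem_b hr.le hrρ hxc))
      have h2 := hq.nonneg x
      simp only [wf, h1, zero_div]
      linarith
  have cw := wf_conts hU hq hr hrρ
  have cV := Vf_conts hU T hr hrρ
  have hS : (∫ θ : sphere (0 : EuclideanSpace ℝ (Fin n)) 1, wf u p r θ * Zf u G r θ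
        ∂(volume : Measure (EuclideanSpace ℝ (Fin n))).toSphere) =
      (∫ θ : sphere (0 : EuclideanSpace ℝ (Fin n)) 1, inner ℝ (Vf G T r θ) (θ : EuclideanSpace ℝ (Fin n)) * wf u p r θ
        ∂(volume : Measure (EuclideanSpace ℝ (Fin n))).toSphere) -
      2 * ∫ θ : sphere (0 : EuclideanSpace ℝ (Fin n)) 1, wf u p r θ ^ 2
        ∂(volume : Measure (EuclideanSpace ℝ (Fin n))).toSphere := by
    rw [← integral_const_mul, ← integral_sub (sph_int (by fun_prop)) (sph_int (by fun_prop))]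
    refine integral_congr_ae (.of_forall fun θ => ?_)
    simp only [← Zf_eq (u := u) (G := G) hq]
    ring
  simp only [Wf] at hW
  rw [hS]
  linarith

lemma H_mono (hU : UData u G ρ) (hq : QData T p) (hW : ∀ r, 0 < r → r < ρ → 0 ≤ Wf u p G T r)
    {a b : ℝ} (ha : 0 < a) (hab : a ≤ b) (hb : b < ρ) :
    Hf u p a ≤ Hf u p b := by
  obtain ⟨C, hC0, hC⟩ := taylor_unif hU hq ha hb
  set K := 2 * (C * C)
  refine mono_of_quad _ a b (K * (volume : Measure (EuclideanSpace ℝ (Fin n))).toSphere.real univ) hab ?_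
  intro r s har hrs hsb
  have hr : 0 < r := by linarith
  have hs : 0 < s := by linarith
  have cw := wf_conts hU hq hr (by linarith)
  have cw' := wf_conts hU hq hs (by linarith)
  have cZ := Zf_conts hU hq hr (by linarith)
  have hN := N_nonneg hU hq hr (by linarith) (hW r hr (by linarith))
  have := sph_mono_const (n := n) (f := fun θ => wf u p s θ ^ 2 - wf u p r θ ^ 2 - 2 * ((s - r) / r) * (wf u p r θ * Zf u G r θ))
    (by fun_prop) (-(K * (s - r) ^ 2)) (fun θ => by
      obtain ⟨h1, -, h2⟩ := hC θ r s har hrs hsb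
      set w' := wf u p s θ
      set w := wf u p r θ
      set Z := Zf u G r θ
      set D := s - r
      set e := w' - w - D / r * Z with he
      have h3 : |e * w| ≤ C * D ^ 2 * C := by rw [abs_mul]; gcongr
      have h8 := (abs_le.1 h3).1
      have : w' ^ 2 - w ^ 2 - 2 * (D / r) * (w * Z) = (w' - w) ^ 2 + 2 * (e * w) := by rw [he]; ring
      rw [this]
      simp only [K]
      nlinarith [sq_nonneg (w' - w)])
  rw [integral_sub (sph_int (by fun_prop)) (sph_int (by fun_prop)),
    integral_sub (sph_int (by fun_prop)) (sph_int (by fun_prop)), integral_const_mul] at this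
  have h9 : 0 ≤ 2 * ((s - r) / r) := by
    have : 0 ≤ s - r := by linarith
    positivity
  have := mul_nonneg h9 hN
  simp only [Hf]
  linarith

lemma W_nonneg (hU : UData u G ρ) (hq : QData T p)
    {T0 : EuclideanSpace ℝ (Fin n) →L[ℝ] EuclideanSpace ℝ (Fin n)} {p0 : EuclideanSpace ℝ (Fin n) → ℝ}
    (hq0 : QData T0 p0) (rk : ℕ → ℝ) (hrk : ∀ k, 0 < rk k) (hrk0 : Tendsto rk atTop (𝓝 0))
    (hconv : TendstoLocallyUniformly (fun k x => u (rk k • x) / rk k ^ 2) p0 atTop)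
    {r : ℝ} (hr : 0 < r) (hrρ : r < ρ) : 0 ≤ Wf u p G T r := by
  set m := (volume : Measure (EuclideanSpace ℝ (Fin n))).toSphere.real univ with hm
  have hm0 : 0 ≤ m := measureReal_nonneg
  have key : ∀ ε > 0, -(ε ^ 2 * m) ≤ Wf u p G T r := by
    intro ε hε
    have h1 : TendstoUniformlyOn (fun k x => u (rk k • x) / rk k ^ 2) p0 atTop
        (sphere (0 : EuclideanSpace ℝ (Fin n)) 1) :=
      (tendstoLocallyUniformlyOn_iff_tendstoUniformlyOn_of_compact (isCompact_sphere _ _)).1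
        hconv.tendstoLocallyUniformlyOn
    have h2 := Metric.tendstoUniformlyOn_iff.1 h1 ε hε
    have h3 : ∀ᶠ k in atTop, rk k < r := hrk0.eventually_lt_const hr
    obtain ⟨k, hk2, hk3⟩ := (h2.and h3).exists
    have h4 := weiss_mono hU hq (hrk k) hk3.le hrρ
    have h5 := weiss_lower hU hq hq0 (hrk k) (hk3.trans hrρ)
    have cw := wf_conts hU hq0 (hrk k) (hk3.trans hrρ)
    have h6 := sph_mono_const (n := n) (f := fun θ => -(wf u p0 (rk k) θ ^ 2)) (by fun_prop) (-ε ^ 2) (fun θ => by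
      have := hk2 θ θ.2
      rw [dist_comm, Real.dist_eq] at this
      have h7 : |wf u p0 (rk k) θ| ≤ ε := this.le
      have : wf u p0 (rk k) θ ^ 2 ≤ ε ^ 2 := by rw [← sq_abs]; gcongr
      linarith)
    rw [integral_neg] at h6
    linarith
  have hl : Tendsto (fun ε : ℝ => -(ε ^ 2 * m)) (𝓝[>] 0) (𝓝 (-((0 : ℝ) ^ 2 * m))) :=
    (Continuous.tendsto (by fun_prop) 0).mono_left nhdsWithin_le_nhds
  have := le_of_tendsto hl (by filter_upwards [self_mem_nhdsWithin] with ε hε using key ε hε)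
  simpa using this
end



lemma unif_meas_fin {X : Type*} [MetricSpace X] [CompactSpace X] [Nonempty X] [MeasurableSpace X] [BorelSpace X]
    (μ ν : Measure X) [IsFiniteMeasure μ] [IsFiniteMeasure ν] [ν.IsOpenPosMeasure]
    (hμ : ∀ x y t, μ (ball x t) = μ (ball y t)) (hν : ∀ x y t, ν (ball x t) = ν (ball y t)) :
    ∃ c : ℝ, 0 ≤ c ∧ ∀ f : X → ℝ, Continuous f → ∫ x, f x ∂μ = c * ∫ x, f x ∂ν := by
  have hint : ∀ (m : Measure X) [IsFiniteMeasure m] (f : X → ℝ), Continuous f → Integrable f m :=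
    fun m _ f hf => hf.integrable_of_hasCompactSupport (HasCompactSupport.of_compactSpace f)
  obtain ⟨x0⟩ := ‹Nonempty X›
  have hν0 : 0 < ν.real univ := by
    rw [measureReal_def]
    exact ENNReal.toReal_pos (isOpen_univ.measure_ne_zero ν ⟨x0, trivial⟩) (measure_ne_top _ _)
  -- Fubini
  have fub : ∀ t, ∀ f : X → ℝ, Continuous f →
      ∫ x, ∫ y in ball x t, f y ∂ν ∂μ = μ.real (ball x0 t) * ∫ y, f y ∂ν := by
    intro t f hf
    have hS : MeasurableSet {q : X × X | dist q.1 q.2 < t} :=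
      (isOpen_lt (by fun_prop) continuous_const).measurableSet
    have hI : Integrable ({q : X × X | dist q.1 q.2 < t}.indicator fun q => f q.2) (μ.prod ν) :=
      Integrable.indicator ((hf.comp continuous_snd).integrable_of_hasCompactSupport
        (HasCompactSupport.of_compactSpace _)) hS
    have h1 : ∀ x, ∫ y in ball x t, f y ∂ν =
        ∫ y, ({q : X × X | dist q.1 q.2 < t}.indicator fun q => f q.2) (x, y) ∂ν := by
      intro x
      rw [← integral_indicator measurableSet_ball]
      congr 1; ext y
      simp [indicator, dist_comm]
    have h2 : ∀ y, ∫ x, ({q : X × X | dist q.1 q.2 < t}.indicator fun q => f q.2) (x, y) ∂μ =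
        μ.real (ball x0 t) * f y := by
      intro y
      have : μ.real (ball x0 t) * f y = ∫ x in ball y t, f y ∂μ := by
        rw [setIntegral_const, smul_eq_mul, measureReal_def, measureReal_def, hμ x0 y]
      rw [this, ← integral_indicator measurableSet_ball]
      congr 1
    simp_rw [h1]
    rw [integral_integral_swap (f := fun x y => ({q : X × X | dist q.1 q.2 < t}.indicator fun q => f q.2) (x, y)) hI]
    simp_rw [h2]
    rw [integral_const_mul]
  set c := μ.real univ / ν.real univ with hc
  have hg : ∀ t, μ.real (ball x0 t) = c * ν.real (ball x0 t) := by
    intro t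
    have := fub t (fun _ => 1) continuous_const
    simp only [integral_const, smul_eq_mul, mul_one, measureReal_restrict_apply_univ] at this
    have h2 : ∀ x, ν.real (ball x t) = ν.real (ball x0 t) := fun x => by
      rw [measureReal_def, measureReal_def, hν x x0]
    simp only [h2, integral_const, smul_eq_mul] at this
    rw [hc]; field_simp
    linarith
  refine ⟨c, by positivity, fun f hf => ?_⟩
  have key : ∀ ε > 0, |c * ∫ x, f x ∂ν - ∫ x, f x ∂μ| ≤ ε * μ.real univ := by
    intro ε hε
    obtain ⟨t, ht, hft⟩ := Metric.uniformContinuous_iff.1 (CompactSpace.uniformContinuous_of_continuous hf) ε hε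
    set h := ν.real (ball x0 t) with hh
    have hpos : 0 < h := by
      rw [hh, measureReal_def]
      exact ENNReal.toReal_pos (isOpen_ball.measure_ne_zero ν ⟨x0, mem_ball_self ht⟩) (measure_ne_top _ _)
    have hx : ∀ x, ‖∫ y in ball x t, f y ∂ν - h * f x‖ ≤ ε * h := by
      intro x
      have e1 : ν.real (ball x t) = h := by rw [hh, measureReal_def, measureReal_def, hν x x0]
      have e2 : h * f x = ∫ y in ball x t, f x ∂ν := by rw [setIntegral_const, smul_eq_mul, e1]
      rw [e2, ← integral_sub (hint ν f hf).integrableOn (integrable_const _), ← e1]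
      refine norm_setIntegral_le_of_norm_le_const (measure_lt_top _ _) (fun y hy => ?_)
      exact (hft (mem_ball.1 hy)).le
    have hIf := fub t f hf
    rw [hg t] at hIf
    have hImeas : Integrable (fun x => ∫ y in ball x t, f y ∂ν) μ := by
      have hS : MeasurableSet {q : X × X | dist q.1 q.2 < t} :=
        (isOpen_lt (by fun_prop) continuous_const).measurableSet
      have hI : Integrable ({q : X × X | dist q.1 q.2 < t}.indicator fun q => f q.2) (μ.prod ν) :=
        Integrable.indicator ((hf.comp continuous_snd).integrable_of_hasCompactSupport
          (HasCompactSupport.of_compactSpace _)) hS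
      refine hI.integral_prod_left.congr (.of_forall fun x => ?_)
      simp only
      rw [← integral_indicator measurableSet_ball]
      congr 1; ext y
      simp [indicator, dist_comm]
    have h5 : ∫ x, (∫ y in ball x t, f y ∂ν - h * f x) ∂μ = h * (c * ∫ x, f x ∂ν - ∫ x, f x ∂μ) := by
      rw [integral_sub hImeas ((hint μ f hf).const_mul h), hIf, integral_const_mul]
      ring
    have h6 := norm_integral_le_of_norm_le_const (μ := μ) (.of_forall hx)
    rw [h5, norm_mul, Real.norm_of_nonneg hpos.le, Real.norm_eq_abs] at h6
    refine le_of_mul_le_mul_left (h6.trans (le_of_eq ?_)) hpos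
    ring
  have hl : Tendsto (fun ε : ℝ => ε * μ.real univ) (𝓝[>] 0) (𝓝 (0 * μ.real univ)) :=
    (Continuous.tendsto (by fun_prop) 0).mono_left nhdsWithin_le_nhds
  have := ge_of_tendsto hl (by filter_upwards [self_mem_nhdsWithin] with ε hε using key ε hε)
  rw [zero_mul] at this
  have := abs_eq_zero.1 (le_antisymm this (abs_nonneg _))
  linarith

lemma unif_meas {X : Type*} [MetricSpace X] [CompactSpace X] [Nonempty X] [MeasurableSpace X] [BorelSpace X]
    (μ ν : Measure X) [IsFiniteMeasure ν] [ν.IsOpenPosMeasure]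
    (hμ : ∀ x y t, μ (ball x t) = μ (ball y t)) (hν : ∀ x y t, ν (ball x t) = ν (ball y t)) :
    ∃ c : ℝ, 0 ≤ c ∧ ∀ f : X → ℝ, Continuous f → (∀ x, 0 ≤ f x) → ∫ x, f x ∂μ = c * ∫ x, f x ∂ν := by
  by_cases hfin : μ univ < ∞
  · have : IsFiniteMeasure μ := ⟨hfin⟩
    obtain ⟨c, hc, h⟩ := unif_meas_fin μ ν hμ hν
    exact ⟨c, hc, fun f hf _ => h f hf⟩
  · refine ⟨0, le_rfl, fun f hf hf0 => ?_⟩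
    rw [zero_mul]
    by_cases hz : ∀ x, f x = 0
    · simp [hz]
    push Not at hz
    obtain ⟨x0, hx0⟩ := hz
    have hpos : 0 < f x0 := lt_of_le_of_ne (hf0 x0) (Ne.symm hx0)
    refine integral_undef fun hI => hfin ?_
    have hlt : μ {x | f x0 / 2 ≤ f x} < ∞ := hI.measure_ge_lt_top (by positivity)
    obtain ⟨t, ht, hball⟩ := Metric.isOpen_iff.1 (isOpen_lt continuous_const hf : IsOpen {x | f x0 / 2 < f x}) x0
      (by simp only [mem_ofPred_eq]; linarith)
    have hbt : μ (ball x0 t) < ∞ := by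
      refine (measure_mono fun x hx => ?_).trans_lt hlt
      have h3 := hball hx
      rw [mem_ofPred_eq] at h3 ⊢
      exact h3.le
    obtain ⟨s, -, hs⟩ := isCompact_univ.elim_nhds_subcover (fun x : X => ball x t) (fun x _ => ball_mem_nhds x ht)
    refine (measure_mono hs).trans_lt ((measure_biUnion_finset_le _ _).trans_lt ?_)
    refine ENNReal.sum_lt_top.2 fun x _ => ?_
    rw [hμ x x0]; exact hbt

section
variable {n : ℕ}

lemma sph_ball_image (x : sphere (0 : EuclideanSpace ℝ (Fin n)) 1) (t : ℝ) :
    ((↑) '' ball x t : Set (EuclideanSpace ℝ (Fin n))) = ball (x : EuclideanSpace ℝ (Fin n)) t ∩ sphere 0 1 := by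
  ext y
  constructor
  · rintro ⟨z, hz, rfl⟩
    exact ⟨hz, z.2⟩
  · rintro ⟨h1, h2⟩
    exact ⟨⟨y, h2⟩, h1, rfl⟩

lemma sph_ball_map (e : EuclideanSpace ℝ (Fin n) ≃ₗᵢ[ℝ] EuclideanSpace ℝ (Fin n))
    (x y : sphere (0 : EuclideanSpace ℝ (Fin n)) 1)
    (h : e x = y) (t : ℝ) :
    e '' ((↑) '' ball x t) = ((↑) '' ball y t : Set (EuclideanSpace ℝ (Fin n))) := by
  rw [sph_ball_image, sph_ball_image, image_inter e.injective, e.image_ball, e.image_sphere, h, map_zero]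

lemma sph_trans (x y : sphere (0 : EuclideanSpace ℝ (Fin n)) 1) :
    ∃ e : EuclideanSpace ℝ (Fin n) ≃ₗᵢ[ℝ] EuclideanSpace ℝ (Fin n), e x = y :=
  ⟨_, Submodule.reflection_sub (by rw [norm_eq_of_mem_sphere, norm_eq_of_mem_sphere])⟩

lemma haus_ball (d : ℝ) (x y : sphere (0 : EuclideanSpace ℝ (Fin n)) 1) (t : ℝ) :
    Measure.comap Subtype.val (μH[d] : Measure (EuclideanSpace ℝ (Fin n))) (ball x t) =
    Measure.comap Subtype.val (μH[d] : Measure (EuclideanSpace ℝ (Fin n))) (ball y t) := by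
  obtain ⟨e, he⟩ := sph_trans x y
  rw [comap_subtype_coe_apply isClosed_sphere.measurableSet, comap_subtype_coe_apply isClosed_sphere.measurableSet,
    ← sph_ball_map e x y he]
  exact (e.toIsometryEquiv.hausdorffMeasure_image d _).symm

open scoped Pointwise in
lemma toSph_ball (x y : sphere (0 : EuclideanSpace ℝ (Fin n)) 1) (t : ℝ) :
    (volume : Measure (EuclideanSpace ℝ (Fin n))).toSphere (ball x t) =
    (volume : Measure (EuclideanSpace ℝ (Fin n))).toSphere (ball y t) := by
  obtain ⟨e, he⟩ := sph_trans x y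
  rw [Measure.toSphere_apply' _ measurableSet_ball, Measure.toSphere_apply' _ measurableSet_ball,
    ← sph_ball_map e x y he]
  congr 1
  have : Ioo (0 : ℝ) 1 • (e '' ((↑) '' ball x t)) = e.symm ⁻¹' (Ioo (0 : ℝ) 1 • ((↑) '' ball x t)) := by
    have h1 : e.symm ⁻¹' (Ioo (0 : ℝ) 1 • ((↑) '' ball x t)) = e '' (Ioo (0 : ℝ) 1 • ((↑) '' ball x t)) := 
      (e.toEquiv.image_eq_preimage_symm _).symm
    rw [h1]
    ext z
    simp only [Set.mem_smul, mem_image]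
    constructor
    · rintro ⟨a, ha, _, ⟨b, hb, rfl⟩, rfl⟩
      exact ⟨a • b, ⟨a, ha, b, hb, rfl⟩, by simp⟩
    · rintro ⟨_, ⟨a, ha, b, hb, rfl⟩, rfl⟩
      exact ⟨a, ha, e b, ⟨b, hb, rfl⟩, by simp⟩
  rw [this]
  exact (e.symm.measurePreserving.measure_preimage_emb e.symm.toHomeomorph.measurableEmbedding _).symm

lemma haus_sphere (hn : 2 ≤ n) (d : ℝ) : ∃ c : ℝ, 0 ≤ c ∧ ∀ f : EuclideanSpace ℝ (Fin n) → ℝ,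
    Continuous (fun θ : sphere (0 : EuclideanSpace ℝ (Fin n)) 1 => f θ) → (∀ x, 0 ≤ f x) →
    ∫ x in sphere (0 : EuclideanSpace ℝ (Fin n)) 1, f x ∂(μH[d]) =
      c * ∫ θ : sphere (0 : EuclideanSpace ℝ (Fin n)) 1, f θ
        ∂(volume : Measure (EuclideanSpace ℝ (Fin n))).toSphere := by
  have : Nonempty (sphere (0 : EuclideanSpace ℝ (Fin n)) 1) :=
    ⟨⟨EuclideanSpace.single ⟨0, by omega⟩ 1, by simp⟩⟩
  have : CompactSpace (sphere (0 : EuclideanSpace ℝ (Fin n)) 1) := isCompact_iff_compactSpace.1 (isCompact_sphere _ _)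
  obtain ⟨c, hc, h⟩ := unif_meas (Measure.comap Subtype.val (μH[d] : Measure (EuclideanSpace ℝ (Fin n))))
    (volume : Measure (EuclideanSpace ℝ (Fin n))).toSphere (haus_ball d) toSph_ball
  refine ⟨c, hc, fun f hf hf0 => ?_⟩
  rw [← integral_subtype_comap isClosed_sphere.measurableSet]
  exact h _ hf fun x => hf0 x

open scoped Pointwise in
lemma haus_scale {d : ℝ} (hd : 0 ≤ d) {r : ℝ} (hr : 0 < r) (f : EuclideanSpace ℝ (Fin n) → ℝ) :
    ∫ x in sphere (0 : EuclideanSpace ℝ (Fin n)) r, f x ∂(μH[d]) =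
      r ^ d * ∫ x in sphere (0 : EuclideanSpace ℝ (Fin n)) 1, f (r • x) ∂(μH[d]) := by
  have hemb : MeasurableEmbedding (fun x : EuclideanSpace ℝ (Fin n) => r • x) :=
    (Homeomorph.smulOfNeZero r hr.ne').measurableEmbedding
  have hm : (μH[d] : Measure (EuclideanSpace ℝ (Fin n))) =
      (‖r‖₊ ^ d : ℝ≥0) • Measure.map (fun x : EuclideanSpace ℝ (Fin n) => r • x) μH[d] := by
    ext s hs
    rw [Measure.smul_apply, hemb.map_apply, ← Measure.hausdorffMeasure_smul₀ hd hr.ne']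
    congr 1
    rw [preimage_smul₀ hr.ne', smul_inv_smul₀ hr.ne']
  conv_lhs => rw [hm]
  rw [Measure.restrict_smul, integral_smul_nnreal_measure, hemb.setIntegral_map]
  have h1 : (fun x : EuclideanSpace ℝ (Fin n) => r • x) ⁻¹' sphere 0 r = sphere 0 1 := by
    ext x
    simp [norm_smul, abs_of_pos hr, hr.ne']
  rw [h1, NNReal.smul_def, smul_eq_mul, NNReal.coe_rpow, coe_nnnorm, Real.norm_of_nonneg hr.le]
end


lemma quad_inner {n : ℕ} (A : Matrix (Fin n) (Fin n) ℝ) (x : EuclideanSpace ℝ (Fin n)) :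
    inner ℝ (Matrix.toEuclideanCLM (𝕜 := ℝ) A x) x = 2 * quadForm A x := by
  rw [real_inner_comm, Matrix.inner_toEuclideanCLM]
  simp only [quadForm, dotProduct, Matrix.mulVec, Finset.mul_sum]
  refine Finset.sum_congr rfl fun i _ => Finset.sum_congr rfl fun j _ => ?_
  ring

lemma quad_smul {n : ℕ} (A : Matrix (Fin n) (Fin n) ℝ) (r : ℝ) (x : EuclideanSpace ℝ (Fin n)) :
    quadForm A (r • x) = r ^ 2 * quadForm A x := by
  have h1 := quad_inner A (r • x)
  have h2 := quad_inner A x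
  rw [map_smul, inner_smul_left, inner_smul_right, h2, conj_trivial] at h1
  linarith

lemma qdata {n : ℕ} {A : Matrix (Fin n) (Fin n) ℝ} (hA : MemP A) :
    QData (Matrix.toEuclideanCLM (𝕜 := ℝ) A) (quadForm A) where
  hom := quad_inner A
  nonneg x := by
    have h := hA.1.dotProduct_mulVec_nonneg x.ofLp
    have h2 := quad_inner A x
    rw [real_inner_comm, Matrix.inner_toEuclideanCLM] at h2
    rw [star_trivial, h2] at h
    linarith
  div x := by
    simp only [dvg, ContinuousLinearMap.fderiv]
    refine Eq.trans ?_ hA.2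
    rw [Matrix.trace]
    refine Finset.sum_congr rfl fun i _ => ?_
    simp [Matrix.diag]
  grad x := by
    rw [hasGradientAt_iff_hasFDerivAt]
    have h1 := (Matrix.toEuclideanCLM (𝕜 := ℝ) A).hasFDerivAt (x := x)
    have h2 := (h1.inner ℝ (hasFDerivAt_id x)).const_mul (1 / 2 : ℝ)
    refine (h2.congr_fderiv ?_).congr_of_eventuallyEq (.of_forall fun y => ?_)
    · ext y
      have hs : inner ℝ (Matrix.toEuclideanCLM (𝕜 := ℝ) A y) x = inner ℝ (Matrix.toEuclideanCLM (𝕜 := ℝ) A x) y := by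
        rw [real_inner_comm, real_inner_comm y, Matrix.inner_toEuclideanCLM, Matrix.inner_toEuclideanCLM]
        have hT : A.transpose = A := by
          have := hA.1.1
          rwa [Matrix.IsHermitian, Matrix.conjTranspose_eq_transpose_of_trivial] at this
        conv_lhs => rw [← hT]
        rw [Matrix.mulVec_transpose, dotProduct_comm, ← Matrix.dotProduct_mulVec]
      simp [fderivInnerCLM_apply, hs]
      ring
    · have := quad_inner A y
      simp only [id]
      linarith

lemma udata {n : ℕ} (hn : 2 ≤ n) {Ω : Set (EuclideanSpace ℝ (Fin n))} (hΩ : IsOpen Ω)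
    {u : EuclideanSpace ℝ (Fin n) → ℝ} (hu : IsObstacleSol Ω u) {ρ : ℝ}
    (hball : ball (0 : EuclideanSpace ℝ (Fin n)) ρ ⊆ Ω) : UData u (gradient u) ρ where
  hn := hn
  grad x hx := (hu.1 x (hball hx)).hasGradientAt
  lip b hb := hu.2.1 _ ((closedBall_subset_ball hb).trans hball) (isCompact_closedBall _ _)
  nonneg x hx := hu.2.2.1 x (hball hx)
  lap := by
    filter_upwards [(ae_restrict_iff' hΩ.measurableSet).1 hu.2.2.2] with x hx hxb using hx (hball hxb)

lemma monneau_eq {n : ℕ} (hn : 2 ≤ n) (u : EuclideanSpace ℝ (Fin n) → ℝ)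
    (A : Matrix (Fin n) (Fin n) ℝ) {ρ : ℝ} {G : EuclideanSpace ℝ (Fin n) → EuclideanSpace ℝ (Fin n)}
    (hU : UData u G ρ) (hA : MemP A) :
    ∃ c : ℝ, 0 ≤ c ∧ ∀ r, 0 < r → r < ρ → monneauM n u A r = c * Hf u (quadForm A) r := by
  obtain ⟨c, hc, h⟩ := haus_sphere hn ((n : ℝ) - 1)
  refine ⟨c, hc, fun r hr hrρ => ?_⟩
  have hd : (0 : ℝ) ≤ (n : ℝ) - 1 := by
    have : (2 : ℝ) ≤ n := by exact_mod_cast hn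
    linarith
  have hpow : r ^ ((n : ℝ) - 1) = r ^ (n - 1) := by
    rw [← Real.rpow_natCast, Nat.cast_sub (by omega), Nat.cast_one]
  have hw : ∀ x, (u (r • x) - quadForm A (r • x)) ^ 2 = r ^ 4 * wf u (quadForm A) r x ^ 2 := by
    intro x
    rw [quad_smul, wf]
    field_simp
  rw [monneauM, haus_scale hd hr, hpow]
  simp only [hw]
  rw [integral_const_mul, h (fun x => wf u (quadForm A) r x ^ 2) ((wf_conts hU (qdata hA) hr hrρ).pow 2)
    (fun x => sq_nonneg _), Hf]
  have : r ^ (n + 3) = r ^ (n - 1) * r ^ 4 := by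
    rw [← pow_add]; congr 1; omega
  rw [this]
  field_simp

/-- Monneau monotonicity formula: if `u` solves the normalized
obstacle problem on `Ω`, `0 ∈ Σ` is a singular point, `B_ρ(0) ⊆ Ω` and `p ∈ 𝒫`,
then `r ↦ M(r,u,p)` is nondecreasing on `(0, ρ)`. -/
theorem monneau_monotonicity
    {n : ℕ} (hn : 2 ≤ n)
    (Ω : Set (EuclideanSpace ℝ (Fin n))) (hΩopen : IsOpen Ω)
    (u : EuclideanSpace ℝ (Fin n) → ℝ) (hu : IsObstacleSol Ω u)
    (h0 : IsSingularPt Ω u 0)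
    (ρ : ℝ) (hρ : 0 < ρ) (hball : ball (0 : EuclideanSpace ℝ (Fin n)) ρ ⊆ Ω)
    (A : Matrix (Fin n) (Fin n) ℝ) (hA : MemP A) :
    MonotoneOn (monneauM n u A) (Ioo 0 ρ) := by
  have hU := udata hn hΩopen hu hball
  obtain ⟨-, rk, A0, hrk, hrk0, hA0, hconv⟩ := h0
  simp only [zero_add] at hconv
  obtain ⟨c, hc, hM⟩ := monneau_eq hn u A hU hA
  intro a ha b hb hab
  rw [hM a ha.1 ha.2, hM b hb.1 hb.2]
  refine mul_le_mul_of_nonneg_left ?_ hc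
  exact H_mono hU (qdata hA) (fun r hr hrρ => W_nonneg hU (qdata hA) (qdata hA0) rk hrk hrk0 hconv hr hrρ)
    ha.1 hab hb.2
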